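/- Assume f satisfies the basic assumptions and hypothesis (H), and in addition there exists ε₀ > 0 such that for every (t,x) ∈ ℝ², f(t,x,·) is C² on the interval I_{t,x} := [(1−ε₀)p(t,x), (1+ε₀)p(t,x)], the map u ↦ f(t,x,u)/u is nonincreasing on I_{t,x}, and f_uu(t,x,u) ≤ 0 for u ∈ I_{t,x}. Then for every g₀ < h₀, every u₀ ∈ H(g₀,h₀), and every classical solution (u,g,h) of the free boundary problem (1.1) with this initial data (u extended by 0 outside [g(t),h(t)]), there exists t₀ > 0 such that u(t₀,x) < p(0,x) for all x ∈ ℝ. -/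

import Mathlib

open Filter Topology Set

noncomputable section

/-- `u` solves `u_t = d u_xx + f(t,x,u)` classically at every point `(t,x)` of the set `s`:
the spatial function is twice differentiable there and the time derivative exists and
equals `d u_xx + f(t,x,u)`. -/
def SolvesPDE (d : ℝ) (f : ℝ → ℝ → ℝ → ℝ) (u : ℝ → ℝ → ℝ) (s : Set (ℝ × ℝ)) : Prop :=
  ∀ q ∈ s,
    DifferentiableAt ℝ (u q.1) q.2 ∧
    DifferentiableAt ℝ (deriv (u q.1)) q.2 ∧
    HasDerivAt (fun t => u t q.2)
      (d * deriv (deriv (u q.1)) q.2 + f q.1 q.2 (u q.1 q.2)) q.1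

/-- Basic assumptions on the reaction term `f(t,x,u)` (for `u ≥ 0`): continuity,
Hölder continuity of class `C^{α/2,α}` in `(t,x)` locally uniformly in `u`,
`C¹` in `u` uniformly in `(t,x)`, `f(t,x,0) = 0`, nonpositivity for large `u`,
and space-time periodicity. -/
structure BasicAssumptions (ω L : ℝ) (f : ℝ → ℝ → ℝ → ℝ) : Prop where
  cont : ContinuousOn (fun q : ℝ × ℝ × ℝ => f q.1 q.2.1 q.2.2) {q : ℝ × ℝ × ℝ | 0 ≤ q.2.2}
  holder : ∃ α ∈ Set.Ioo (0:ℝ) 1, ∀ R > 0, ∃ C > 0, ∀ t s x y u : ℝ,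
    0 ≤ u → u ≤ R → |f t x u - f s y u| ≤ C * (|t - s| ^ (α / 2) + |x - y| ^ α)
  c1 : ∃ fu : ℝ → ℝ → ℝ → ℝ,
    (∀ t x u : ℝ, 0 ≤ u → HasDerivWithinAt (fun w => f t x w) (fu t x u) (Set.Ici 0) u) ∧
    ∀ ε > 0, ∃ δ > 0, ∀ t x u v : ℝ, 0 ≤ u → 0 ≤ v → |u - v| ≤ δ →
      |fu t x u - fu t x v| ≤ ε
  zero : ∀ t x : ℝ, f t x 0 = 0
  neg_large : ∃ M > 0, ∀ t x u : ℝ, M ≤ u → f t x u ≤ 0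
  per_t : ∀ t x u : ℝ, 0 ≤ u → f (t + ω) x u = f t x u
  per_x : ∀ t x u : ℝ, 0 ≤ u → f t (x + L) u = f t x u

/-- A bounded classical solution of the Cauchy problem
`v_t = d v_xx + f(t,x,v)` on `(0,∞) × ℝ` with initial datum `v₀`. -/
structure IsCauchySolution (d : ℝ) (f : ℝ → ℝ → ℝ → ℝ) (v₀ : ℝ → ℝ) (v : ℝ → ℝ → ℝ) : Prop where
  init : ∀ x, v 0 x = v₀ x
  cont : ContinuousOn (fun q : ℝ × ℝ => v q.1 q.2) {q : ℝ × ℝ | 0 ≤ q.1}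
  pde : SolvesPDE d f v {q : ℝ × ℝ | 0 < q.1}
  bdd : ∃ C, ∀ t ≥ (0:ℝ), ∀ x, |v t x| ≤ C

/-- Hypothesis (H): `p` is the unique positive space-time periodic solution of
`p_t = d p_xx + f(t,x,p)`, and every bounded solution of the Cauchy problem with
initial datum bounded below by a positive constant converges to `p` uniformly. -/
structure HypH (d ω L : ℝ) (f : ℝ → ℝ → ℝ → ℝ) (p : ℝ → ℝ → ℝ) : Prop where
  pos : ∀ t x, 0 < p t x
  per_t : ∀ t x, p (t + ω) x = p t x
  per_x : ∀ t x, p t (x + L) = p t x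
  sol : SolvesPDE d f p Set.univ
  uniq : ∀ q : ℝ → ℝ → ℝ, (∀ t x, 0 < q t x) → (∀ t x, q (t + ω) x = q t x) →
    (∀ t x, q t (x + L) = q t x) → SolvesPDE d f q Set.univ → q = p
  conv : ∀ v₀ : ℝ → ℝ, Continuous v₀ → (∃ C, ∀ x, |v₀ x| ≤ C) →
    (∃ ε > 0, ∀ x, ε ≤ v₀ x) →
    ∀ v : ℝ → ℝ → ℝ, IsCauchySolution d f v₀ v →
    ∀ ε > 0, ∃ S, ∀ s ≥ S, ∀ t ≥ (0:ℝ), ∀ x : ℝ, |v (t + s) x - p (t + s) x| ≤ ε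

/-- The class `H(g₀,h₀)` of admissible initial data on `[g₀,h₀]`. -/
def memH (g₀ h₀ : ℝ) (φ : ℝ → ℝ) : Prop :=
  ContinuousOn φ (Set.Icc g₀ h₀) ∧ φ g₀ = 0 ∧ φ h₀ = 0 ∧ ∀ x ∈ Set.Ioo g₀ h₀, 0 < φ x

/-- A classical solution `(u, g, h)` of the free boundary problem (1.1) with
Stefan constant `μ` and initial data `u₀ ∈ H(g₀,h₀)`, with `u` extended by `0`
outside `[g(t), h(t)]`. -/
structure IsFBPSolution (d μ : ℝ) (f : ℝ → ℝ → ℝ → ℝ) (g₀ h₀ : ℝ) (u₀ : ℝ → ℝ)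
    (u : ℝ → ℝ → ℝ) (g h : ℝ → ℝ) : Prop where
  g_init : g 0 = g₀
  h_init : h 0 = h₀
  g_smooth : ContDiffOn ℝ 1 g (Set.Ici 0)
  h_smooth : ContDiffOn ℝ 1 h (Set.Ici 0)
  u_cont : ContinuousOn (fun q : ℝ × ℝ => u q.1 q.2)
    {q : ℝ × ℝ | 0 ≤ q.1 ∧ g q.1 ≤ q.2 ∧ q.2 ≤ h q.1}
  pde : SolvesPDE d f u {q : ℝ × ℝ | 0 < q.1 ∧ g q.1 < q.2 ∧ q.2 < h q.1}
  bc_left : ∀ t > (0:ℝ), u t (g t) = 0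
  bc_right : ∀ t > (0:ℝ), u t (h t) = 0
  stefan_left : ∀ t > (0:ℝ),
    HasDerivAt g (-μ * derivWithin (u t) (Set.Ici (g t)) (g t)) t
  stefan_right : ∀ t > (0:ℝ),
    HasDerivAt h (-μ * derivWithin (u t) (Set.Iic (h t)) (h t)) t
  init : ∀ x ∈ Set.Icc g₀ h₀, u 0 x = u₀ x
  ext : ∀ t ≥ (0:ℝ), ∀ x : ℝ, (x < g t ∨ h t < x) → u t x = 0


open MeasureTheory

/-- `z_t - d z_xx = r` at the point `(t,x)`. -/
def POp (d : ℝ) (z : ℝ → ℝ → ℝ) (t x r : ℝ) : Prop :=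
  ∃ (zx : ℝ → ℝ) (zxx zt : ℝ), (∀ᶠ y in 𝓝 x, HasDerivAt (z t) (zx y) y) ∧
    HasDerivAt zx zxx x ∧ HasDerivAt (fun s => z s x) zt t ∧ zt - d * zxx = r

theorem POp.add {d : ℝ} {z w : ℝ → ℝ → ℝ} {t x r q : ℝ} (hz : POp d z t x r) (hw : POp d w t x q) :
    POp d (fun t x => z t x + w t x) t x (r + q) := by
  obtain ⟨zx, zxx, zt, h1, h2, h3, h4⟩ := hz
  obtain ⟨wx, wxx, wt, k1, k2, k3, k4⟩ := hw
  refine ⟨fun y => zx y + wx y, zxx + wxx, zt + wt, ?_, h2.add k2, h3.add k3, by rw [← h4, ← k4]; ring⟩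
  filter_upwards [h1, k1] with y a b using a.add b

theorem POp.mul_time {d : ℝ} {z : ℝ → ℝ → ℝ} {t x r : ℝ} (hz : POp d z t x r) {c : ℝ → ℝ} {c' : ℝ}
    (hc : HasDerivAt c c' t) :
    POp d (fun t x => c t * z t x) t x (c t * r + c' * z t x) := by
  obtain ⟨zx, zxx, zt, h1, h2, h3, h4⟩ := hz
  refine ⟨fun y => c t * zx y, c t * zxx, c' * z t x + c t * zt, ?_, h2.const_mul _, hc.mul h3, by
    rw [← h4]; ring⟩
  filter_upwards [h1] with y a using a.const_mul _

theorem POp.const_mul {d : ℝ} {z : ℝ → ℝ → ℝ} {t x r : ℝ} (c : ℝ) (hz : POp d z t x r) :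
    POp d (fun t x => c * z t x) t x (c * r) := by
  simpa using hz.mul_time (c := fun _ => c) (hasDerivAt_const t c)

theorem POp.neg {d : ℝ} {z : ℝ → ℝ → ℝ} {t x r : ℝ} (hz : POp d z t x r) :
    POp d (fun t x => - z t x) t x (- r) := by
  simpa using hz.const_mul (-1)

theorem POp.sub {d : ℝ} {z w : ℝ → ℝ → ℝ} {t x r q : ℝ} (hz : POp d z t x r) (hw : POp d w t x q) :
    POp d (fun t x => z t x - w t x) t x (r - q) := by
  simpa [sub_eq_add_neg] using hz.add hw.neg

theorem POp.time {d : ℝ} {t x : ℝ} {c : ℝ → ℝ} {c' : ℝ} (hc : HasDerivAt c c' t) :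
    POp d (fun t _ => c t) t x c' := by
  refine ⟨fun y => 0, 0, c', ?_, hasDerivAt_const _ _, hc, by ring⟩
  exact Eventually.of_forall fun y => hasDerivAt_const _ _

theorem POp.const {d : ℝ} {t x : ℝ} (c : ℝ) : POp d (fun _ _ => c) t x 0 :=
  POp.time (hasDerivAt_const _ _)

theorem POp.space {d : ℝ} {t x : ℝ} {b b1 : ℝ → ℝ} {b2 : ℝ} (h1 : ∀ y, HasDerivAt b (b1 y) y)
    (h2 : HasDerivAt b1 b2 x) :
    POp d (fun _ x => b x) t x (-d * b2) := by
  refine ⟨b1, b2, 0, Eventually.of_forall h1, h2, hasDerivAt_const _ _, by ring⟩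

theorem POp.shift {d : ℝ} {z : ℝ → ℝ → ℝ} {t x r : ℝ} (a b : ℝ) (hz : POp d z (a + t) (b + x) r) :
    POp d (fun t x => z (a + t) (b + x)) t x r := by
  obtain ⟨zx, zxx, zt, h1, h2, h3, h4⟩ := hz
  refine ⟨fun y => zx (b + y), zxx, zt, ?_, h2.comp_const_add b x,
    HasDerivAt.comp_const_add (f := fun s => z s (b + x)) a t h3, h4⟩
  have : Tendsto (fun y => b + y) (𝓝 x) (𝓝 (b + x)) := (continuous_const.add continuous_id).tendsto x
  filter_upwards [this.eventually h1] with y hy using hy.comp_const_add b y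

theorem POp.solves {d : ℝ} {f : ℝ → ℝ → ℝ → ℝ} {z : ℝ → ℝ → ℝ} {t x : ℝ}
    (hz : POp d z t x (f t x (z t x))) :
    DifferentiableAt ℝ (z t) x ∧ DifferentiableAt ℝ (deriv (z t)) x ∧
    HasDerivAt (fun s => z s x) (d * deriv (deriv (z t)) x + f t x (z t x)) t := by
  obtain ⟨zx, zxx, zt, h1, h2, h3, h4⟩ := hz
  have e : deriv (z t) =ᶠ[𝓝 x] zx := by
    filter_upwards [h1] with y hy using hy.deriv
  have h2' := h2.congr_of_eventuallyEq e
  refine ⟨h1.self_of_nhds.differentiableAt, h2'.differentiableAt, ?_⟩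
  rw [h2'.deriv, ← h4]
  convert h3 using 1; ring

theorem POp.of_solves {d : ℝ} {f : ℝ → ℝ → ℝ → ℝ} {z : ℝ → ℝ → ℝ} {s : Set (ℝ × ℝ)}
    (h : SolvesPDE d f z s) {t x : ℝ} (hx : ∀ᶠ y in 𝓝 x, (t, y) ∈ s) :
    POp d z t x (f t x (z t x)) := by
  obtain ⟨h1, h2, h3⟩ := h (t, x) hx.self_of_nhds
  refine ⟨deriv (z t), _, _, ?_, h2.hasDerivAt, h3, by simp⟩
  filter_upwards [hx] with y hy using (h (t, y) hy).1.hasDerivAt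

theorem POp.nonneg_of_max {d : ℝ} (hd : 0 < d) {z : ℝ → ℝ → ℝ} {t x r : ℝ} (hz : POp d z t x r)
    (ht : ∀ᶠ s in 𝓝[<] t, z s x ≤ z t x) (hx : IsLocalMax (z t) x) : 0 ≤ r := by
  obtain ⟨zx, zxx, zt, h1, h2, h3, h4⟩ := hz
  have hzt : 0 ≤ zt := by
    have := (hasDerivWithinAt_iff_tendsto_slope' (s := Iio t) (by simp)).1 h3.hasDerivWithinAt
    refine ge_of_tendsto this ?_
    filter_upwards [ht, self_mem_nhdsWithin] with s hs hs'
    rw [slope_def_field]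
    have : s < t := hs'
    apply div_nonneg_of_nonpos <;> linarith
  have hzxx : zxx ≤ 0 := by
    by_contra! hpos
    have e : deriv (z t) =ᶠ[𝓝 x] zx := by
      filter_upwards [h1] with y hy using hy.deriv
    have h2' := h2.congr_of_eventuallyEq e
    have h0 : deriv (z t) x = 0 := hx.deriv_eq_zero
    have hmin : IsLocalMin (z t) x := by
      apply isLocalMin_of_deriv_deriv_pos _ h0 h1.self_of_nhds.continuousAt
      rw [h2'.deriv]; exact hpos
    have hc : z t =ᶠ[𝓝 x] fun _ => z t x := by
      filter_upwards [hmin, hx] with y a b using le_antisymm b a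
    have h3 : deriv (z t) =ᶠ[𝓝 x] fun _ => 0 := by
      have := hc.deriv
      simpa using this
    have := h3.deriv_eq
    rw [h2'.deriv] at this
    simp at this
    linarith
  nlinarith

/-- Maximum principle on `[0,T] × ℝ`. -/
theorem max_principle {d C T : ℝ} (hd : 0 < d) (z : ℝ → ℝ → ℝ)
    (hc : ContinuousOn (fun q : ℝ × ℝ => z q.1 q.2) (Icc 0 T ×ˢ univ))
    (hb : ∃ B, ∀ t ∈ Icc 0 T, ∀ x, z t x ≤ B) (h0 : ∀ x, z 0 x ≤ 0)
    (hz : ∀ t ∈ Ioc 0 T, ∀ x, 0 < z t x → ∃ r, POp d z t x r ∧ r ≤ C * z t x) :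
    ∀ t ∈ Icc 0 T, ∀ x, z t x ≤ 0 := by
  intro t1 ht1 x1
  by_contra! hpos
  obtain ⟨B, hB⟩ := hb
  set k : ℝ := max C 0 + 2 * d + 1 with hk
  have hC0 : 0 ≤ max C 0 := le_max_right _ _
  have hk0 : 0 ≤ k := by positivity
  set ε : ℝ := Real.exp (-k * t1) * z t1 x1 / (2 * (1 + x1 ^ 2)) with hε
  have hε0 : 0 < ε := by positivity
  have hy1 : 0 < Real.exp (-k * t1) * z t1 x1 - ε * (1 + x1 ^ 2) := by
    have : ε * (1 + x1 ^ 2) = Real.exp (-k * t1) * z t1 x1 / 2 := by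
      rw [hε]; field_simp
    rw [this]
    have : 0 < Real.exp (-k * t1) * z t1 x1 := by positivity
    linarith
  have hB0 : 0 < B := hpos.trans_le (hB _ ht1 _)
  set R : ℝ := |x1| + B / ε + 1 with hR
  have hBε : 0 < B / ε := by positivity
  have hR1 : 1 ≤ R := by have := abs_nonneg x1; linarith
  have hRB : B ≤ ε * R := by
    have : ε * (B / ε) = B := by field_simp
    have := abs_nonneg x1
    nlinarith
  set y : ℝ → ℝ → ℝ := fun t x => Real.exp (-k * t) * z t x - ε * (1 + x ^ 2) with hy
  have hyc : ContinuousOn (fun q : ℝ × ℝ => y q.1 q.2) (Icc 0 T ×ˢ univ) := by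
    apply ContinuousOn.sub
    · apply ContinuousOn.mul _ hc
      fun_prop
    · fun_prop
  have hcomp : IsCompact (Icc (0:ℝ) T ×ˢ Icc (-R) R) := isCompact_Icc.prod isCompact_Icc
  have hmem1 : ((t1, x1) : ℝ × ℝ) ∈ Icc (0:ℝ) T ×ˢ Icc (-R) R := by
    refine ⟨ht1, ?_⟩
    have := neg_abs_le x1
    have := le_abs_self x1
    constructor <;> simp only <;> linarith
  obtain ⟨⟨t2, x2⟩, hm2, hmax⟩ := hcomp.exists_isMaxOn ⟨_, hmem1⟩
    (hyc.mono (prod_mono Subset.rfl (subset_univ _)))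
  have hy2 : 0 < y t2 x2 := hy1.trans_le (hmax hmem1)
  have hglob : ∀ t ∈ Icc 0 T, ∀ x, y t x ≤ y t2 x2 := by
    intro t ht x
    by_cases hx : x ∈ Icc (-R) R
    · exact hmax (show (t, x) ∈ _ from ⟨ht, hx⟩)
    · have hx' : R ^ 2 ≤ x ^ 2 := by
        simp only [mem_Icc, not_and_or, not_le] at hx
        rcases hx with h | h <;> nlinarith
      have : y t x ≤ 0 := by
        simp only [hy]
        have e1 : Real.exp (-k * t) ≤ 1 := by
          rw [Real.exp_le_one_iff]; have := mul_nonneg hk0 ht.1; linarith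
        have e0 := Real.exp_pos (-k * t)
        have : Real.exp (-k * t) * z t x ≤ B := by
          have := hB t ht x
          calc Real.exp (-k * t) * z t x ≤ Real.exp (-k * t) * B := by gcongr
            _ ≤ 1 * B := by gcongr
            _ = B := one_mul _
        have : ε * R ≤ ε * (1 + x ^ 2) := by
          apply mul_le_mul_of_nonneg_left _ hε0.le
          nlinarith
        linarith
      linarith
  have ht2 : t2 ∈ Icc 0 T := hm2.1
  have ht2' : 0 < t2 := by
    rcases ht2.1.lt_or_eq with h | h
    · exact h
    · exfalso
      rw [← h] at hy2
      have := h0 x2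
      simp only [hy] at hy2
      simp at hy2
      have : 0 < ε * (1 + x2 ^ 2) := by positivity
      linarith
  have e0 := Real.exp_pos (-k * t2)
  have hez : ε * (1 + x2 ^ 2) < Real.exp (-k * t2) * z t2 x2 := by
    simp only [hy] at hy2; linarith
  have hz2 : 0 < z t2 x2 := by
    have : 0 < ε * (1 + x2 ^ 2) := by positivity
    exact (mul_pos_iff_of_pos_left e0).1 (this.trans hez)
  obtain ⟨r, hr, hrC⟩ := hz t2 ⟨ht2', ht2.2⟩ x2 hz2
  have hexp : HasDerivAt (fun t => Real.exp (-k * t)) (Real.exp (-k * t2) * -k) t2 := by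
    have := ((hasDerivAt_id t2).const_mul (-k)).exp
    simpa using this
  have hsp : POp d (fun _ x => ε * (1 + x ^ 2)) t2 x2 (-d * (ε * 2)) := by
    apply POp.space (b1 := fun x => ε * (2 * x))
    · intro y
      have := ((hasDerivAt_pow 2 y).const_add 1).const_mul ε
      simpa using this
    · have := ((hasDerivAt_id x2).const_mul 2).const_mul ε
      simpa using this
  have hop := (hr.mul_time hexp).sub hsp
  have hnn := hop.nonneg_of_max hd (by
    have : Ioo 0 t2 ∈ 𝓝[<] t2 := Ioo_mem_nhdsLT ht2'
    filter_upwards [this] with s hs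
    exact hglob s ⟨hs.1.le, hs.2.le.trans ht2.2⟩ x2) (by
    exact Eventually.of_forall fun x => hglob t2 ht2 x)
  have h1 : r ≤ max C 0 * z t2 x2 := hrC.trans (by gcongr; exact le_max_left _ _)
  have h2 : Real.exp (-k * t2) * r ≤ max C 0 * (Real.exp (-k * t2) * z t2 x2) := by
    calc _ ≤ Real.exp (-k * t2) * (max C 0 * z t2 x2) := by gcongr
      _ = _ := by ring
  have h3 : ε ≤ Real.exp (-k * t2) * z t2 x2 := by
    refine le_trans ?_ hez.le
    nlinarith [sq_nonneg x2]
  have : (2 * d + 1) * ε ≤ (2 * d + 1) * (Real.exp (-k * t2) * z t2 x2) := by gcongr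
  rw [hk] at *
  nlinarith

open MeasureTheory in
theorem integrable_wt : Integrable (fun z : ℝ => ((1 + z ^ 2) ^ 2)⁻¹) := by
  refine integrable_inv_one_add_sq.mono' ?_ ?_
  · apply Measurable.aestronglyMeasurable; fun_prop
  · refine Eventually.of_forall fun z => ?_
    rw [Real.norm_of_nonneg (by positivity)]
    apply inv_anti₀ (by positivity)
    nlinarith [sq_nonneg z]


/-- Nice kernels. -/
def Nice (k : ℝ → ℝ) : Prop :=
  Continuous k ∧ ∃ C, 0 ≤ C ∧ ∀ z, |k z| ≤ C * ((1 + z ^ 2) ^ 2)⁻¹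

theorem Nice.integrable {k : ℝ → ℝ} (hk : Nice k) : Integrable k := by
  obtain ⟨hc, C, hC, h⟩ := hk
  exact (integrable_wt.const_mul C).mono' hc.aestronglyMeasurable (Eventually.of_forall h)

/-- Scaled kernel operator. -/
def KS (k : ℝ → ℝ) (S : ℝ → ℝ → ℝ) (τ s x : ℝ) : ℝ := ∫ z, S s (x + √τ * z) * k z

theorem KS_continuous {k : ℝ → ℝ} (hk : Nice k) {S : ℝ → ℝ → ℝ} {B : ℝ}
    (hS : Continuous (fun q : ℝ × ℝ => S q.1 q.2)) (hB : ∀ s x, |S s x| ≤ B) :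
    Continuous (fun q : ℝ × ℝ × ℝ => KS k S q.1 q.2.1 q.2.2) := by
  unfold KS
  apply continuous_of_dominated (bound := fun z => B * |k z|)
  · intro q
    apply Continuous.aestronglyMeasurable
    have := hk.1
    have : Continuous fun z => S q.2.1 (q.2.2 + √q.1 * z) :=
      hS.comp (f := fun z => (q.2.1, q.2.2 + √q.1 * z)) (by fun_prop)
    exact this.mul hk.1
  · intro q
    refine Eventually.of_forall fun z => ?_
    rw [Real.norm_eq_abs, abs_mul]
    gcongr
    exact hB _ _
  · exact hk.integrable.abs.const_mul B
  · refine Eventually.of_forall fun z => ?_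
    have : Continuous fun q : ℝ × ℝ × ℝ => S q.2.1 (q.2.2 + √q.1 * z) :=
      hS.comp (f := fun q : ℝ × ℝ × ℝ => (q.2.1, q.2.2 + √q.1 * z)) (by fun_prop)
    exact this.mul continuous_const

theorem KS_bound {k : ℝ → ℝ} (hk : Nice k) {S : ℝ → ℝ → ℝ} {B : ℝ} {s : ℝ}
    (hB : ∀ x, |S s x| ≤ B) (τ x : ℝ) : |KS k S τ s x| ≤ B * ∫ z, |k z| := by
  unfold KS
  rw [← integral_const_mul, ← Real.norm_eq_abs]
  apply norm_integral_le_of_norm_le (hk.integrable.abs.const_mul B)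
  refine Eventually.of_forall fun z => ?_
  rw [Real.norm_eq_abs, abs_mul]
  gcongr
  exact hB _

theorem KS_kernel (k : ℝ → ℝ) (S : ℝ → ℝ → ℝ) {τ : ℝ} (hτ : 0 < τ) (s x : ℝ) :
    KS k S τ s x = ∫ y, S s y * ((√τ)⁻¹ * k ((y - x) / √τ)) := by
  have hs : 0 < √τ := Real.sqrt_pos.2 hτ
  set G : ℝ → ℝ := fun y => S s y * k ((y - x) / √τ) with hG
  have h1 : KS k S τ s x = ∫ z, G (x + √τ * z) := by
    unfold KS; congr 1; ext z
    simp only [hG]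
    congr 2; field_simp; ring
  rw [h1]
  have h2 := Measure.integral_comp_mul_left (fun y => G (x + y)) (√τ)
  rw [h2, integral_add_left_eq_self, abs_of_pos (inv_pos.2 hs), smul_eq_mul, ← integral_const_mul]
  congr 1; ext y; simp only [hG]; ring

theorem integrable_wt' {c : ℝ} (hc : 0 < c) (x : ℝ) :
    Integrable (fun y : ℝ => ((1 + ((y - x) / c) ^ 2) ^ 2)⁻¹) := by
  have := (integrable_wt.comp_div hc.ne').comp_sub_right x
  exact this

theorem integrable_kernel {k : ℝ → ℝ} (hk : Nice k) {φ : ℝ → ℝ} (hφ : Continuous φ) {B : ℝ}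
    (hB : ∀ x, |φ x| ≤ B) {τ : ℝ} (hτ : 0 < τ) (x : ℝ) :
    Integrable (fun y => φ y * ((√τ)⁻¹ * k ((y - x) / √τ))) := by
  have hs : 0 < √τ := Real.sqrt_pos.2 hτ
  have h := ((hk.integrable.comp_div hs.ne').comp_sub_right x).const_mul (√τ)⁻¹
  exact h.bdd_mul hφ.aestronglyMeasurable (Eventually.of_forall hB)

theorem wt_shift {z w : ℝ} (h : |z - w| ≤ 1) : ((1 + w ^ 2) ^ 2)⁻¹ ≤ 9 * ((1 + z ^ 2) ^ 2)⁻¹ := by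
  have h1 : 1 + z ^ 2 ≤ 3 * (1 + w ^ 2) := by
    have := abs_le.1 h
    nlinarith [sq_nonneg (z - 2 * w)]
  rw [inv_eq_one_div, inv_eq_one_div, ← mul_div_assoc, div_le_div_iff₀ (by positivity) (by positivity)]
  have : (1 + z ^ 2) ^ 2 ≤ (3 * (1 + w ^ 2)) ^ 2 := by gcongr
  nlinarith

theorem KS_deriv_x {k k' : ℝ → ℝ} (hk : Nice k) (hk' : Nice k') (hd : ∀ z, HasDerivAt k (k' z) z)
    {S : ℝ → ℝ → ℝ} {s : ℝ} (hS : Continuous (S s)) {B : ℝ} (hB : ∀ x, |S s x| ≤ B)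
    {τ : ℝ} (hτ : 0 < τ) (x : ℝ) :
    HasDerivAt (KS k S τ s) (-(√τ)⁻¹ * KS k' S τ s x) x := by
  have hs : 0 < √τ := Real.sqrt_pos.2 hτ
  obtain ⟨C, hC, hCk⟩ := hk'.2
  have hB0 : 0 ≤ B := (abs_nonneg _).trans (hB 0)
  have e1 : KS k S τ s = fun x => ∫ y, S s y * ((√τ)⁻¹ * k ((y - x) / √τ)) := by
    ext x; exact KS_kernel k S hτ s x
  rw [e1]
  have e2 : -(√τ)⁻¹ * KS k' S τ s x =
      ∫ y, S s y * ((√τ)⁻¹ * (k' ((y - x) / √τ) * (-1 / √τ))) := by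
    rw [KS_kernel k' S hτ s x, ← integral_const_mul]
    congr 1; ext y; ring
  rw [e2]
  refine (hasDerivAt_integral_of_dominated_loc_of_deriv_le
    (F' := fun x y => S s y * ((√τ)⁻¹ * (k' ((y - x) / √τ) * (-1 / √τ))))
    (bound := fun y => B * ((√τ)⁻¹ * (C * (9 * ((1 + ((y - x) / √τ) ^ 2) ^ 2)⁻¹) * (1 / √τ))))
    (Metric.ball_mem_nhds x hs) ?_ ?_ ?_ ?_ ?_ ?_).2
  · refine Eventually.of_forall fun x => ?_
    exact (integrable_kernel hk hS hB hτ x).aestronglyMeasurable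
  · exact integrable_kernel hk hS hB hτ x
  · apply Continuous.aestronglyMeasurable
    have := hk'.1
    fun_prop
  · refine Eventually.of_forall fun y x' hx' => ?_
    rw [Real.norm_eq_abs, abs_mul, abs_mul, abs_mul, abs_of_pos (inv_pos.2 hs), abs_div, abs_neg,
      abs_one, abs_of_pos hs]
    gcongr
    · exact hB y
    · refine (hCk _).trans ?_
      gcongr
      apply wt_shift
      rw [← sub_div, abs_div, abs_of_pos hs, div_le_one hs]
      rw [Metric.mem_ball, Real.dist_eq] at hx'
      have : y - x - (y - x') = x' - x := by ring
      rw [this]; exact hx'.le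
  · exact (((((integrable_wt' hs x).const_mul 9).const_mul C).mul_const _).const_mul _).const_mul _
  · refine Eventually.of_forall fun y x' hx' => ?_
    apply HasDerivAt.const_mul
    apply HasDerivAt.const_mul
    have h1 : HasDerivAt (fun x => (y - x) / √τ) (-1 / √τ) x' :=
      ((hasDerivAt_id x').const_sub y).div_const _
    exact (hd _).comp x' h1

theorem wt_scale {z w : ℝ} (h : z ^ 2 ≤ 2 * w ^ 2) :
    ((1 + w ^ 2) ^ 2)⁻¹ ≤ 4 * ((1 + z ^ 2) ^ 2)⁻¹ := by
  have h1 : 1 + z ^ 2 ≤ 2 * (1 + w ^ 2) := by nlinarith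
  rw [inv_eq_one_div, inv_eq_one_div, ← mul_div_assoc, div_le_div_iff₀ (by positivity) (by positivity)]
  have : (1 + z ^ 2) ^ 2 ≤ (2 * (1 + w ^ 2)) ^ 2 := by gcongr
  nlinarith

theorem KS_deriv_t {k k' j : ℝ → ℝ} (hk : Nice k) (hj : Nice j) (hd : ∀ z, HasDerivAt k (k' z) z)
    (hjk : ∀ z, k z + z * k' z = j z)
    {S : ℝ → ℝ → ℝ} {s : ℝ} (hS : Continuous (S s)) {B : ℝ} (hB : ∀ x, |S s x| ≤ B)
    {τ : ℝ} (hτ : 0 < τ) (x : ℝ) :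
    HasDerivAt (fun τ => KS k S τ s x) (-(2 * τ)⁻¹ * KS j S τ s x) τ := by
  have hs : 0 < √τ := Real.sqrt_pos.2 hτ
  obtain ⟨C, hC, hCk⟩ := hj.2
  have hB0 : 0 ≤ B := (abs_nonneg _).trans (hB 0)
  have e1 : (fun τ => KS k S τ s x) =ᶠ[𝓝 τ]
      fun τ => ∫ y, S s y * ((√τ)⁻¹ * k ((y - x) / √τ)) := by
    filter_upwards [lt_mem_nhds hτ] with τ hτ
    exact KS_kernel k S hτ s x
  refine HasDerivAt.congr_of_eventuallyEq ?_ e1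
  have e2 : -(2 * τ)⁻¹ * KS j S τ s x =
      ∫ y, S s y * (-(2 * τ)⁻¹ * ((√τ)⁻¹ * j ((y - x) / √τ))) := by
    rw [KS_kernel j S hτ s x, ← integral_const_mul]
    congr 1; ext y; ring
  rw [e2]
  have hτ2 : 0 < τ / 2 := by linarith
  have hnb : Ioo (τ / 2) (2 * τ) ∈ 𝓝 τ := Ioo_mem_nhds (by linarith) (by linarith)
  have hs2 : 0 < √(τ / 2) := Real.sqrt_pos.2 hτ2
  refine (hasDerivAt_integral_of_dominated_loc_of_deriv_le
    (F' := fun τ y => S s y * (-(2 * τ)⁻¹ * ((√τ)⁻¹ * j ((y - x) / √τ))))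
    (bound := fun y => B * ((2 * (τ / 2))⁻¹ * ((√(τ/2))⁻¹ *
      (C * (4 * ((1 + ((y - x) / √τ) ^ 2) ^ 2)⁻¹)))))
    hnb ?_ ?_ ?_ ?_ ?_ ?_).2
  · filter_upwards [lt_mem_nhds hτ] with τ hτ
    exact (integrable_kernel hk hS hB hτ x).aestronglyMeasurable
  · exact integrable_kernel hk hS hB hτ x
  · apply Continuous.aestronglyMeasurable
    have := hj.1
    fun_prop
  · refine Eventually.of_forall fun y τ' hτ' => ?_
    have hp : 0 < τ' := hτ2.trans hτ'.1
    have hsp : 0 < √τ' := Real.sqrt_pos.2 hp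
    rw [Real.norm_eq_abs, abs_mul, abs_mul, abs_mul, abs_of_pos (inv_pos.2 hsp), abs_neg,
      abs_of_pos (by positivity : 0 < (2 * τ')⁻¹)]
    gcongr
    · exact hB y
    · exact hτ'.1.le
    · exact hτ'.1.le
    · refine (hCk _).trans ?_
      gcongr
      apply wt_scale
      rw [div_pow, div_pow, Real.sq_sqrt hτ.le, Real.sq_sqrt hp.le, ← mul_div_assoc,
        div_le_div_iff₀ hτ hp]
      have := hτ'.2
      nlinarith [sq_nonneg (y - x)]
  · exact (((((integrable_wt' hs x).const_mul 4).const_mul C).const_mul _).const_mul _).const_mul _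
  · refine Eventually.of_forall fun y τ' hτ' => ?_
    have hp : 0 < τ' := hτ2.trans hτ'.1
    have hsp : 0 < √τ' := Real.sqrt_pos.2 hp
    apply HasDerivAt.const_mul
    have hsq := Real.hasDerivAt_sqrt hp.ne'
    have h1 := hsq.inv hsp.ne'
    have h2 : HasDerivAt (fun τ => k ((y - x) / √τ)) _ τ' :=
      (hd _).comp τ' ((hasDerivAt_const τ' (y - x)).div hsq hsp.ne')
    refine HasDerivAt.congr_deriv (h1.mul h2) ?_
    rw [← hjk]
    have e : τ' = √τ' ^ 2 := (Real.sq_sqrt hp.le).symm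
    set r := √τ'
    rw [e]
    simp only [Pi.inv_apply, Real.sqrt_sq hsp.le]
    field_simp
    ring

/-- The Gaussian and its derivatives. -/
def gk (d z : ℝ) : ℝ := Real.exp (-(1 / (4 * d)) * z ^ 2) / √(Real.pi / (1 / (4 * d)))
/-- First derivative. -/
def gk1 (d z : ℝ) : ℝ := -z / (2 * d) * gk d z
/-- Second derivative. -/
def gk2 (d z : ℝ) : ℝ := (z ^ 2 / (4 * d ^ 2) - 1 / (2 * d)) * gk d z

theorem gk_nonneg (d z : ℝ) : 0 ≤ gk d z := by unfold gk; positivity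

theorem gk_integral {d : ℝ} (hd : 0 < d) : ∫ z, gk d z = 1 := by
  unfold gk
  rw [integral_div, integral_gaussian, div_self]
  positivity

theorem gk_hasDeriv {d : ℝ} (hd : 0 < d) (z : ℝ) : HasDerivAt (gk d) (gk1 d z) z := by
  unfold gk1 gk
  have := (((hasDerivAt_pow 2 z).const_mul (-(1 / (4 * d)))).exp).div_const (√(Real.pi / (1 / (4 * d))))
  refine HasDerivAt.congr_deriv this ?_
  push_cast
  field_simp
  ring

theorem gk1_hasDeriv {d : ℝ} (hd : 0 < d) (z : ℝ) : HasDerivAt (gk1 d) (gk2 d z) z := by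
  have h1 : HasDerivAt (fun z : ℝ => -z / (2 * d)) (-1 / (2 * d)) z :=
    ((hasDerivAt_id z).neg).div_const _
  have := h1.mul (gk_hasDeriv hd z)
  refine HasDerivAt.congr_deriv this ?_
  unfold gk2 gk1
  field_simp
  ring

theorem gk_bound {d : ℝ} (hd : 0 < d) : ∃ C, 0 ≤ C ∧ ∀ z, gk d z * (1 + z ^ 2) ^ 3 ≤ C := by
  refine ⟨(1 + 4 * d) ^ 3 * (6 * Real.exp 1) / √(Real.pi / (1 / (4 * d))), by positivity, fun z => ?_⟩
  unfold gk
  rw [div_mul_eq_mul_div]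
  apply div_le_div_of_nonneg_right _ (Real.sqrt_nonneg _)
  set y := z ^ 2 / (4 * d) with hy
  have hy0 : 0 ≤ y := by positivity
  have hz : z ^ 2 = 4 * d * y := by rw [hy]; field_simp
  have h1 : (1 + y) ^ 3 / 6 ≤ Real.exp (1 + y) := by
    have := Real.pow_div_factorial_le_exp (1 + y) (by positivity) 3
    simpa [Nat.factorial] using this
  have h2 : -(1 / (4 * d)) * z ^ 2 = -y := by rw [hy]; ring
  rw [h2, Real.exp_neg]
  rw [Real.exp_add] at h1
  have h3 : (1 + z ^ 2) ^ 3 ≤ ((1 + 4 * d) * (1 + y)) ^ 3 := by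
    gcongr
    rw [hz]; nlinarith
  rw [inv_mul_le_iff₀ (Real.exp_pos _)]
  calc _ ≤ _ := h3
    _ = (1 + 4 * d) ^ 3 * (1 + y) ^ 3 := by ring
    _ ≤ (1 + 4 * d) ^ 3 * (6 * (Real.exp 1 * Real.exp y)) := by gcongr; linarith
    _ = _ := by ring

theorem gk_continuous (d : ℝ) : Continuous (gk d) := by unfold gk; fun_prop

theorem nice_of {d : ℝ} (hd : 0 < d) {m : ℝ → ℝ} (hm : Continuous m) {A : ℝ}
    (hA : ∀ z, |m z| ≤ A * (1 + z ^ 2)) : Nice (fun z => m z * gk d z) := by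
  obtain ⟨C, hC, h⟩ := gk_bound hd
  have hA0 : 0 ≤ A := by have := (abs_nonneg _).trans (hA 0); simpa using this
  refine ⟨hm.mul (gk_continuous d), A * C, by positivity, fun z => ?_⟩
  rw [abs_mul, abs_of_nonneg (gk_nonneg d z), ← div_eq_mul_inv, le_div_iff₀ (by positivity)]
  calc |m z| * gk d z * (1 + z ^ 2) ^ 2 ≤ A * (1 + z ^ 2) * gk d z * (1 + z ^ 2) ^ 2 := by
        have := gk_nonneg d z
        gcongr; exact hA z
    _ = A * (gk d z * (1 + z ^ 2) ^ 3) := by ring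
    _ ≤ A * C := by gcongr; exact h z

theorem gk_nice {d : ℝ} (hd : 0 < d) : Nice (gk d) := by
  have := nice_of hd (m := fun _ => 1) continuous_const (A := 1) (fun z => by
    simp; positivity)
  simpa using this

theorem gk1_nice {d : ℝ} (hd : 0 < d) : Nice (gk1 d) := by
  refine nice_of hd (m := fun z => -z / (2 * d)) (by fun_prop) (A := 1 / (2 * d)) (fun z => ?_)
  rw [abs_div, abs_neg, abs_of_pos (by positivity : 0 < 2 * d), div_mul_eq_mul_div]
  gcongr
  rw [abs_le]; constructor <;> nlinarith [sq_nonneg (z - 1), sq_nonneg (z + 1)]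

theorem gk2_nice {d : ℝ} (hd : 0 < d) : Nice (gk2 d) := by
  refine nice_of hd (m := fun z => z ^ 2 / (4 * d ^ 2) - 1 / (2 * d)) (by fun_prop)
    (A := 1 / (4 * d ^ 2) + 1 / (2 * d)) (fun z => ?_)
  have h1 : 0 < 1 / (4 * d ^ 2) := by positivity
  have h2 : 0 < 1 / (2 * d) := by positivity
  have h3 : z ^ 2 / (4 * d ^ 2) = 1 / (4 * d ^ 2) * z ^ 2 := by ring
  rw [h3, abs_le]; constructor <;> nlinarith [sq_nonneg z, mul_nonneg h1.le (sq_nonneg z), mul_nonneg h2.le (sq_nonneg z)]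

theorem KS_const (k : ℝ → ℝ) (c τ s x : ℝ) : KS k (fun _ _ => c) τ s x = c * ∫ z, k z := by
  unfold KS; rw [integral_const_mul]

theorem deriv_integral_zero {k k' : ℝ → ℝ} (hk : Nice k) (hk' : Nice k')
    (hd : ∀ z, HasDerivAt k (k' z) z) : ∫ z, k' z = 0 := by
  have h := KS_deriv_x hk hk' hd (S := fun _ _ => 1) (s := 0) continuous_const (B := 1) (by simp)
    (τ := 1) one_pos 0
  have e : KS k (fun _ _ => 1) 1 0 = fun _ => ∫ z, k z := by
    ext x; rw [KS_const]; simp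
  rw [e] at h
  have := h.unique (hasDerivAt_const _ _)
  rw [KS_const] at this
  simpa using this

theorem gk2_integral {d : ℝ} (hd : 0 < d) : ∫ z, gk2 d z = 0 :=
  deriv_integral_zero (gk1_nice hd) (gk2_nice hd) (gk1_hasDeriv hd)

theorem heat_dx {d : ℝ} (hd : 0 < d) {S : ℝ → ℝ → ℝ} {s : ℝ} (hS : Continuous (S s)) {B : ℝ}
    (hB : ∀ x, |S s x| ≤ B) {τ : ℝ} (hτ : 0 < τ) (x : ℝ) :
    HasDerivAt (KS (gk d) S τ s) (-(√τ)⁻¹ * KS (gk1 d) S τ s x) x :=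
  KS_deriv_x (gk_nice hd) (gk1_nice hd) (gk_hasDeriv hd) hS hB hτ x

theorem heat_dxx {d : ℝ} (hd : 0 < d) {S : ℝ → ℝ → ℝ} {s : ℝ} (hS : Continuous (S s)) {B : ℝ}
    (hB : ∀ x, |S s x| ≤ B) {τ : ℝ} (hτ : 0 < τ) (x : ℝ) :
    HasDerivAt (fun x => -(√τ)⁻¹ * KS (gk1 d) S τ s x) (τ⁻¹ * KS (gk2 d) S τ s x) x := by
  have := (KS_deriv_x (gk1_nice hd) (gk2_nice hd) (gk1_hasDeriv hd) hS hB hτ x).const_mul (-(√τ)⁻¹)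
  refine this.congr_deriv ?_
  rw [← mul_assoc, neg_mul_neg, ← mul_inv, Real.mul_self_sqrt hτ.le]

theorem heat_dt {d : ℝ} (hd : 0 < d) {S : ℝ → ℝ → ℝ} {s : ℝ} (hS : Continuous (S s)) {B : ℝ}
    (hB : ∀ x, |S s x| ≤ B) {τ : ℝ} (hτ : 0 < τ) (x : ℝ) :
    HasDerivAt (fun τ => KS (gk d) S τ s x) (d * (τ⁻¹ * KS (gk2 d) S τ s x)) τ := by
  have hn : Nice (fun z => (-2 * d) * gk2 d z) := by
    obtain ⟨h1, C, hC, h⟩ := gk2_nice hd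
    refine ⟨h1.const_mul _, |-2 * d| * C, by positivity, fun z => ?_⟩
    rw [abs_mul, mul_assoc]; gcongr; exact h z
  have := KS_deriv_t (gk_nice hd) hn (gk_hasDeriv hd) (fun z => by
    unfold gk2 gk1; field_simp; ring) hS hB hτ x
  refine this.congr_deriv ?_
  have e : KS (fun z => (-2 * d) * gk2 d z) S τ s x = (-2 * d) * KS (gk2 d) S τ s x := by
    unfold KS; rw [← integral_const_mul]; congr 1; ext z; ring
  rw [e]; field_simp

theorem heat_zero {d : ℝ} (hd : 0 < d) (S : ℝ → ℝ → ℝ) (s x : ℝ) : KS (gk d) S 0 s x = S s x := by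
  unfold KS; simp [integral_const_mul, gk_integral hd]

theorem heat_POp {d : ℝ} (hd : 0 < d) {φ : ℝ → ℝ} (hφ : Continuous φ) {B : ℝ}
    (hB : ∀ x, |φ x| ≤ B) {τ : ℝ} (hτ : 0 < τ) (x : ℝ) :
    POp d (fun t x => KS (gk d) (fun _ => φ) t 0 x) τ x 0 := by
  refine ⟨fun y => -(√τ)⁻¹ * KS (gk1 d) (fun _ => φ) τ 0 y, τ⁻¹ * KS (gk2 d) (fun _ => φ) τ 0 x,
    _, Eventually.of_forall fun y => ?_, ?_,
    heat_dt hd (S := fun _ => φ) (s := 0) hφ hB hτ x, ?_⟩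
  · exact heat_dx hd (S := fun _ => φ) (s := 0) hφ hB hτ y
  · exact heat_dxx hd (S := fun _ => φ) (s := 0) hφ hB hτ x
  · ring

theorem heat_abs_le {d : ℝ} (hd : 0 < d) {S : ℝ → ℝ → ℝ} {B : ℝ} {s : ℝ}
    (hB : ∀ x, |S s x| ≤ B) (τ x : ℝ) : |KS (gk d) S τ s x| ≤ B := by
  have := KS_bound (gk_nice hd) hB τ x
  have e : ∫ z, |gk d z| = 1 := by
    rw [← gk_integral hd]; congr 1; ext z; exact abs_of_nonneg (gk_nonneg d z)
  rwa [e, mul_one] at this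

/-- Hölder estimate for the second derivative kernel. -/
theorem heat2_holder {d : ℝ} (hd : 0 < d) : ∃ A, 0 ≤ A ∧ ∀ (α C B : ℝ) (S : ℝ → ℝ → ℝ) (s : ℝ),
    0 < α → α ≤ 1 → 0 ≤ C → Continuous (S s) → (∀ x, |S s x| ≤ B) →
    (∀ x y, |S s x - S s y| ≤ C * |x - y| ^ α) →
    ∀ τ > 0, ∀ x, |τ⁻¹ * KS (gk2 d) S τ s x| ≤ A * C * τ ^ (α / 2 - 1) := by
  obtain ⟨hc, C2, hC2, h2⟩ := gk2_nice hd
  have hI : Integrable (fun z : ℝ => 2 * (1 + z ^ 2) * (C2 * ((1 + z ^ 2) ^ 2)⁻¹)) := by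
    refine (integrable_inv_one_add_sq.const_mul (2 * C2)).congr (Eventually.of_forall fun z => ?_)
    simp only; field_simp
  refine ⟨∫ z : ℝ, 2 * (1 + z ^ 2) * (C2 * ((1 + z ^ 2) ^ 2)⁻¹),
    integral_nonneg fun z => by positivity, ?_⟩
  intro α C B S s hα hα1 hC hS hB hH τ hτ x
  have hs : 0 < √τ := Real.sqrt_pos.2 hτ
  have hSc : Continuous fun z => S s (x + √τ * z) := hS.comp (by fun_prop)
  have hi : Integrable (fun z => S s (x + √τ * z) * gk2 d z) :=
    (gk2_nice hd).integrable.bdd_mul hSc.aestronglyMeasurable (Eventually.of_forall fun z => hB _)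
  have e : KS (gk2 d) S τ s x = ∫ z, (S s (x + √τ * z) - S s x) * gk2 d z := by
    have : ∫ z, S s x * gk2 d z = 0 := by rw [integral_const_mul, gk2_integral hd, mul_zero]
    rw [KS, ← sub_zero (∫ z, S s (x + √τ * z) * gk2 d z), ← this, ← integral_sub hi
      ((gk2_nice hd).integrable.const_mul _)]
    congr 1; ext z; ring
  have hb : |KS (gk2 d) S τ s x| ≤
      ∫ z : ℝ, (C * √τ ^ α) * (2 * (1 + z ^ 2) * (C2 * ((1 + z ^ 2) ^ 2)⁻¹)) := by
    rw [e, ← Real.norm_eq_abs]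
    apply norm_integral_le_of_norm_le (hI.const_mul _)
    refine Eventually.of_forall fun z => ?_
    rw [Real.norm_eq_abs, abs_mul]
    have h1 : |S s (x + √τ * z) - S s x| ≤ C * √τ ^ α * (2 * (1 + z ^ 2)) := by
      refine (hH _ _).trans ?_
      rw [add_sub_cancel_left, abs_mul, abs_of_pos hs, Real.mul_rpow hs.le (abs_nonneg _), mul_assoc]
      gcongr
      rcases le_total |z| 1 with h | h
      · have := Real.rpow_le_one (abs_nonneg z) h hα.le
        nlinarith [sq_nonneg z]
      · have := Real.rpow_le_rpow_of_exponent_le h hα1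
        rw [Real.rpow_one] at this
        have : |z| ≤ z ^ 2 := by rw [← sq_abs]; nlinarith
        nlinarith [sq_nonneg z]
    calc _ ≤ (C * √τ ^ α * (2 * (1 + z ^ 2))) * (C2 * ((1 + z ^ 2) ^ 2)⁻¹) := by
          gcongr; exact h2 z
      _ = _ := by ring
  rw [integral_const_mul] at hb
  rw [abs_mul, abs_of_pos (inv_pos.2 hτ)]
  have e2 : τ ^ (α / 2 - 1) = τ⁻¹ * √τ ^ α := by
    rw [Real.sqrt_eq_rpow, ← Real.rpow_mul hτ.le, ← Real.rpow_neg_one, ← Real.rpow_add hτ]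
    congr 1; ring
  rw [e2]
  refine (mul_le_mul_of_nonneg_left hb (inv_pos.2 hτ).le).trans (le_of_eq ?_)
  ring


theorem tri_swap {k : ℝ → ℝ → ℝ} (hk : ContinuousOn (fun q : ℝ × ℝ => k q.1 q.2) (Ioi 0 ×ˢ univ))
    {b : ℝ → ℝ} {T : ℝ} (hb : IntegrableOn b (Ioc 0 T)) (hbd : ∀ ρ > 0, ∀ s, |k ρ s| ≤ b ρ)
    {t : ℝ} (ht : t ∈ Icc 0 T) :
    ∫ s in (0:ℝ)..t, ∫ ρ in (0:ℝ)..(t - s), k ρ s =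
      ∫ ρ in Ioc 0 T, ∫ s in (0:ℝ)..(max (t - ρ) 0), k ρ s := by
  set E : Set (ℝ × ℝ) := {q | q.1 + q.2 ≤ t} with hE
  have hEm : MeasurableSet E := (isClosed_le (by fun_prop) continuous_const).measurableSet
  -- q = (ρ, s)
  have h1 : ∫ ρ in Ioc 0 T, ∫ s in (0:ℝ)..(max (t - ρ) 0), k ρ s =
      ∫ ρ in Ioc 0 T, ∫ s in Ioc 0 T, E.indicator (fun q => k q.1 q.2) (ρ, s) := by
    apply setIntegral_congr_fun measurableSet_Ioc
    intro ρ hρ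
    simp only
    have e : ∀ s, E.indicator (fun q => k q.1 q.2) (ρ, s) = (Iic (t - ρ)).indicator (k ρ) s := by
      intro s
      by_cases h : ρ + s ≤ t
      · rw [indicator_of_mem (by exact h), indicator_of_mem (by simp only [mem_Iic]; linarith)]
      · rw [indicator_of_notMem (by exact h), indicator_of_notMem (by simp only [mem_Iic]; linarith)]
    simp only [e]
    rw [setIntegral_indicator measurableSet_Iic, intervalIntegral.integral_of_le (le_max_right _ _)]
    congr 2
    ext s
    simp only [mem_Ioc, mem_inter_iff, mem_Iic, le_max_iff]
    constructor
    · rintro ⟨h, h' | h'⟩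
      · exact ⟨⟨h, by linarith [hρ.1, ht.2]⟩, h'⟩
      · linarith
    · rintro ⟨h, h'⟩; exact ⟨h.1, Or.inl h'⟩
  have h2 : ∫ s in (0:ℝ)..t, ∫ ρ in (0:ℝ)..(t - s), k ρ s =
      ∫ s in Ioc 0 T, ∫ ρ in Ioc 0 T, E.indicator (fun q => k q.1 q.2) (ρ, s) := by
    have e1 : ∀ s ∈ Ioc 0 T, ∫ ρ in Ioc 0 T, E.indicator (fun q => k q.1 q.2) (ρ, s) =
        (Ioc 0 t).indicator (fun s => ∫ ρ in (0:ℝ)..(t - s), k ρ s) s := by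
      intro s hs
      have e : ∀ ρ, E.indicator (fun q => k q.1 q.2) (ρ, s) = (Iic (t - s)).indicator (fun ρ => k ρ s) ρ := by
        intro ρ
        by_cases h : ρ + s ≤ t
        · rw [indicator_of_mem (by exact h), indicator_of_mem (by simp only [mem_Iic]; linarith)]
        · rw [indicator_of_notMem (by exact h), indicator_of_notMem (by simp only [mem_Iic]; linarith)]
      simp only [e]
      rw [setIntegral_indicator measurableSet_Iic]
      by_cases h : s ≤ t
      · rw [indicator_of_mem (by exact ⟨hs.1, h⟩), intervalIntegral.integral_of_le (by linarith)]
        congr 2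
        ext r
        simp only [mem_Ioc, mem_inter_iff, mem_Iic]
        constructor
        · rintro ⟨h, h'⟩; exact ⟨h.1, h'⟩
        · rintro ⟨h, h'⟩; exact ⟨⟨h, by linarith [hs.1, ht.2]⟩, h'⟩
      · rw [indicator_of_notMem (by simp only [mem_Ioc, not_and]; intro; exact h)]
        have : Ioc 0 T ∩ Iic (t - s) = ∅ := by
          ext r; simp only [mem_Ioc, mem_inter_iff, mem_Iic, mem_empty_iff_false, iff_false]
          rintro ⟨h, h'⟩; linarith [h.1]
        rw [this]; simp
    rw [setIntegral_congr_fun measurableSet_Ioc e1, setIntegral_indicator measurableSet_Ioc,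
      intervalIntegral.integral_of_le ht.1]
    congr 2
    ext s; simp only [mem_Ioc, mem_inter_iff]
    constructor
    · rintro ⟨h, h'⟩; exact ⟨⟨h, h'.trans ht.2⟩, h, h'⟩
    · rintro ⟨h, h'⟩; exact h'
  rw [h1, h2]
  symm
  apply integral_integral_swap (f := fun ρ s => E.indicator (fun q => k q.1 q.2) (ρ, s))
  have hm : AEStronglyMeasurable (fun q : ℝ × ℝ => k q.1 q.2)
      ((volume.restrict (Ioc 0 T)).prod (volume.restrict (Ioc 0 T))) := by
    rw [Measure.prod_restrict]
    apply (hk.aestronglyMeasurable (measurableSet_Ioi.prod MeasurableSet.univ)).mono_measure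
    rw [← Measure.volume_eq_prod]
    apply Measure.restrict_mono _ le_rfl
    rintro ⟨r, s⟩ ⟨hr, -⟩
    exact ⟨hr.1, trivial⟩
  have hb' : Integrable (fun q : ℝ × ℝ => b q.1)
      ((volume.restrict (Ioc 0 T)).prod (volume.restrict (Ioc 0 T))) := hb.comp_fst _
  refine hb'.mono' (hm.indicator hEm) ?_
  have : ∀ᵐ q ∂((volume.restrict (Ioc 0 T)).prod (volume.restrict (Ioc 0 T))), q ∈ Ioc 0 T ×ˢ Ioc (0:ℝ) T := by
    rw [Measure.prod_restrict]
    exact ae_restrict_mem (measurableSet_Ioc.prod measurableSet_Ioc)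
  filter_upwards [this] with q hq
  have := hbd q.1 hq.1.1 q.2
  rw [Real.norm_eq_abs]
  change |E.indicator (fun q => k q.1 q.2) q| ≤ _
  by_cases h : q ∈ E
  · rw [indicator_of_mem h]; exact this
  · rw [indicator_of_notMem h, abs_zero]; exact (abs_nonneg _).trans this

theorem tri_deriv {k : ℝ → ℝ → ℝ} (hk : ContinuousOn (fun q : ℝ × ℝ => k q.1 q.2) (Ioi 0 ×ˢ univ))
    {b : ℝ → ℝ} {T : ℝ} (hb : IntegrableOn b (Ioc 0 T)) (hbd : ∀ ρ > 0, ∀ s, |k ρ s| ≤ b ρ)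
    {t : ℝ} (ht : t ∈ Ioo 0 T) :
    HasDerivAt (fun t => ∫ s in (0:ℝ)..t, ∫ ρ in (0:ℝ)..(t - s), k ρ s)
      (∫ ρ in (0:ℝ)..t, k ρ (t - ρ)) t := by
  have hkc : ∀ ρ > 0, Continuous (k ρ) := fun ρ hρ => by
    have : Continuous fun s => (fun q : ℝ × ℝ => k q.1 q.2) (ρ, s) :=
      hk.comp_continuous (by fun_prop) (fun s => ⟨hρ, trivial⟩)
    exact this
  have ev : (fun t => ∫ s in (0:ℝ)..t, ∫ ρ in (0:ℝ)..(t - s), k ρ s) =ᶠ[𝓝 t]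
      fun t => ∫ ρ in Ioc 0 T, ∫ s in (0:ℝ)..(max (t - ρ) 0), k ρ s := by
    filter_upwards [Ioo_mem_nhds ht.1 ht.2] with r hr
    exact tri_swap hk hb hbd ⟨hr.1.le, hr.2.le⟩
  refine HasDerivAt.congr_of_eventuallyEq ?_ ev
  have e : ∫ ρ in (0:ℝ)..t, k ρ (t - ρ) = ∫ ρ in Ioc 0 T, (Iic t).indicator (fun ρ => k ρ (t - ρ)) ρ := by
    rw [setIntegral_indicator measurableSet_Iic, intervalIntegral.integral_of_le ht.1.le]
    congr 2
    ext r; simp only [mem_Ioc, mem_inter_iff, mem_Iic]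
    constructor
    · rintro ⟨h, h'⟩; exact ⟨⟨h, h'.trans ht.2.le⟩, h'⟩
    · rintro ⟨h, h'⟩; exact ⟨h.1, h'⟩
  rw [e]
  have hmeas : ∀ r, AEStronglyMeasurable (fun ρ => ∫ s in (0:ℝ)..(max (r - ρ) 0), k ρ s)
      (volume.restrict (Ioc 0 T)) := by
    intro r
    apply ContinuousOn.aestronglyMeasurable _ measurableSet_Ioc
    have h1 : ContinuousOn (fun ρ => ∫ s in (0:ℝ)..(max (r - ρ) 0), k ρ s) (Ioi 0) := by
      rw [continuousOn_iff_continuous_domRestrict]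
      have hf : Continuous (Function.uncurry fun (ρ : Ioi (0:ℝ)) (s : ℝ) => k ρ s) :=
        hk.comp_continuous (f := fun q : Ioi (0:ℝ) × ℝ => ((q.1 : ℝ), q.2)) (by fun_prop)
          (fun q => ⟨q.1.2, trivial⟩)
      have := intervalIntegral.continuous_parametric_primitive_of_continuous (a₀ := 0) (μ := volume) hf
      exact this.comp (f := fun ρ : Ioi (0:ℝ) => (ρ, max (r - ρ) 0)) (by fun_prop)
    exact h1.mono fun x hx => hx.1
  have key := hasDerivAt_integral_of_dominated_loc_of_lip (μ := volume.restrict (Ioc 0 T))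
    (F := fun t ρ => ∫ s in (0:ℝ)..(max (t - ρ) 0), k ρ s) (x₀ := t) (s := univ) (bound := b)
    (F' := fun ρ => (Iic t).indicator (fun ρ => k ρ (t - ρ)) ρ) univ_mem
    (Eventually.of_forall hmeas) ?_ ?_ ?_ hb ?_
  · exact key.2
  · refine (hb.mul_const T).mono' (hmeas t) ?_
    filter_upwards [ae_restrict_mem measurableSet_Ioc] with ρ hρ
    have h0 : 0 ≤ b ρ := (abs_nonneg _).trans (hbd ρ hρ.1 0)
    have := intervalIntegral.norm_integral_le_of_norm_le_const (a := 0) (b := max (t - ρ) 0) (f := k ρ) (C := b ρ)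
      (fun s _ => hbd ρ hρ.1 s)
    refine this.trans ?_
    gcongr
    rw [sub_zero, abs_of_nonneg (le_max_right _ _)]
    exact max_le (by linarith [hρ.1, ht.2]) (by linarith [ht.1, ht.2])
  · apply AEStronglyMeasurable.indicator _ measurableSet_Iic
    apply ContinuousOn.aestronglyMeasurable _ measurableSet_Ioc
    exact hk.comp (f := fun ρ => (ρ, t - ρ)) (by fun_prop) (fun ρ hρ => ⟨hρ.1, trivial⟩)
  · filter_upwards [ae_restrict_mem measurableSet_Ioc] with ρ hρ
    apply LipschitzOnWith.of_dist_le_mul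
    intro r _ r' _
    simp only [Real.dist_eq]
    rw [intervalIntegral.integral_interval_sub_left ((hkc ρ hρ.1).intervalIntegrable _ _) ((hkc ρ hρ.1).intervalIntegrable _ _)]
    have := intervalIntegral.norm_integral_le_of_norm_le_const (a := max (r' - ρ) 0) (b := max (r - ρ) 0) (f := k ρ) (C := b ρ)
      (fun s _ => hbd ρ hρ.1 s)
    refine this.trans ?_
    have h0 : 0 ≤ b ρ := (abs_nonneg _).trans (hbd ρ hρ.1 0)
    have e : ((Real.nnabs (b ρ) : NNReal) : ℝ) = b ρ := by simp [abs_of_nonneg h0]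
    rw [e]
    apply mul_le_mul_of_nonneg_left _ h0
    have h5 := abs_max_sub_max_le_abs (r - ρ) (r' - ρ) 0
    rwa [sub_sub_sub_cancel_right] at h5
  · have hne : ∀ᵐ ρ ∂(volume.restrict (Ioc 0 T)), ρ ≠ t := by
      apply ae_restrict_of_ae
      exact Measure.ae_ne volume t
    filter_upwards [ae_restrict_mem measurableSet_Ioc, hne] with ρ hρ hn
    rcases lt_or_gt_of_ne hn with h | h
    · rw [indicator_of_mem (by exact h.le)]
      have h1 : HasDerivAt (fun r => ∫ s in (0:ℝ)..(r - ρ), k ρ s) (k ρ (t - ρ)) t := by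
        have := intervalIntegral.integral_hasDerivAt_right ((hkc ρ hρ.1).intervalIntegrable 0 (t - ρ))
          (hkc ρ hρ.1).stronglyMeasurable.stronglyMeasurableAtFilter (hkc ρ hρ.1).continuousAt
        have h2 := HasDerivAt.comp t this ((hasDerivAt_id t).sub_const ρ)
        simpa [Function.comp_def] using h2
      apply h1.congr_of_eventuallyEq
      filter_upwards [Ioi_mem_nhds h] with r hr
      rw [max_eq_left (by linarith [mem_Ioi.1 hr])]
    · rw [indicator_of_notMem (by simpa using h)]
      apply (hasDerivAt_const t (0:ℝ)).congr_of_eventuallyEq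
      filter_upwards [Iio_mem_nhds h] with r hr
      rw [max_eq_right (by linarith [mem_Iio.1 hr])]; simp


/-- Duhamel integral. -/
def Duh (d : ℝ) (S : ℝ → ℝ → ℝ) (t x : ℝ) : ℝ := ∫ σ in (0:ℝ)..t, KS (gk d) S σ (t - σ) x

theorem Duh_continuous {d : ℝ} (hd : 0 < d) {S : ℝ → ℝ → ℝ} {B : ℝ}
    (hS : Continuous (fun q : ℝ × ℝ => S q.1 q.2)) (hB : ∀ s x, |S s x| ≤ B) :
    Continuous (fun q : ℝ × ℝ => Duh d S q.1 q.2) := by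
  have hK := KS_continuous (gk_nice hd) hS hB
  have hf : Continuous (Function.uncurry fun (q : ℝ × ℝ) (σ : ℝ) => KS (gk d) S σ (q.1 - σ) q.2) :=
    hK.comp (f := fun r : (ℝ × ℝ) × ℝ => (r.2, r.1.1 - r.2, r.1.2)) (by fun_prop)
  have := intervalIntegral.continuous_parametric_primitive_of_continuous (a₀ := 0) (μ := volume) hf
  exact this.comp (f := fun q : ℝ × ℝ => (q, q.1)) (by fun_prop)

theorem Duh_bound {d : ℝ} (hd : 0 < d) {S : ℝ → ℝ → ℝ} {B t : ℝ} (ht : 0 ≤ t)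
    (hB : ∀ s x, |S s x| ≤ B) (x : ℝ) : |Duh d S t x| ≤ B * t := by
  have := intervalIntegral.norm_integral_le_of_norm_le_const (a := 0) (b := t)
    (f := fun σ => KS (gk d) S σ (t - σ) x) (C := B) (fun σ _ => heat_abs_le hd (hB _) σ x)
  rwa [sub_zero, abs_of_nonneg ht] at this

theorem Duh_congr {d : ℝ} {S S' : ℝ → ℝ → ℝ} {t : ℝ} (ht : 0 ≤ t)
    (h : ∀ s ∈ Icc 0 t, S s = S' s) (x : ℝ) : Duh d S t x = Duh d S' t x := by
  unfold Duh
  apply intervalIntegral.integral_congr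
  intro σ hσ
  rw [uIcc_of_le ht] at hσ
  simp only [KS]
  rw [h (t - σ) ⟨by linarith [hσ.2], by linarith [hσ.1]⟩]

theorem Duh_zero (d : ℝ) (S : ℝ → ℝ → ℝ) (x : ℝ) : Duh d S 0 x = 0 := by simp [Duh]

theorem int_rpow {α t : ℝ} (ha : -1 < α) : IntervalIntegrable (fun σ : ℝ => σ ^ α) volume 0 t :=
  intervalIntegral.intervalIntegrable_rpow' ha

theorem inv_sqrt_rpow {σ : ℝ} (hσ : 0 < σ) : (√σ)⁻¹ = σ ^ (-(1/2) : ℝ) := by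
  rw [Real.rpow_neg hσ.le, Real.sqrt_eq_rpow]

theorem cOn_k1 {d : ℝ} (hd : 0 < d) {S : ℝ → ℝ → ℝ} {B : ℝ}
    (hS : Continuous (fun q : ℝ × ℝ => S q.1 q.2)) (hB : ∀ s x, |S s x| ≤ B) (t x : ℝ) :
    AEStronglyMeasurable (fun σ => -(√σ)⁻¹ * KS (gk1 d) S σ (t - σ) x) (volume.restrict (uIoc 0 t)) := by
  have h1 : Continuous fun σ => KS (gk1 d) S σ (t - σ) x :=
    (KS_continuous (gk1_nice hd) hS hB).comp (f := fun σ => (σ, t - σ, x)) (by fun_prop)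
  exact (((Real.continuous_sqrt.measurable.inv).neg).mul h1.measurable).aestronglyMeasurable

/-- Spatial derivative of Duhamel integral. -/
def Duh1 (d : ℝ) (S : ℝ → ℝ → ℝ) (t x : ℝ) : ℝ :=
  ∫ σ in (0:ℝ)..t, -(√σ)⁻¹ * KS (gk1 d) S σ (t - σ) x

/-- Second spatial derivative of Duhamel integral. -/
def Duh2 (d : ℝ) (S : ℝ → ℝ → ℝ) (t x : ℝ) : ℝ :=
  ∫ σ in (0:ℝ)..t, σ⁻¹ * KS (gk2 d) S σ (t - σ) x

theorem k1_bound {d : ℝ} (hd : 0 < d) {S : ℝ → ℝ → ℝ} {B : ℝ} (hB : ∀ s x, |S s x| ≤ B)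
    {σ : ℝ} (hσ : 0 < σ) (s x : ℝ) :
    ‖-(√σ)⁻¹ * KS (gk1 d) S σ s x‖ ≤ (B * ∫ z, |gk1 d z|) * σ ^ (-(1/2) : ℝ) := by
  rw [← inv_sqrt_rpow hσ, mul_comm, norm_mul, norm_neg, Real.norm_eq_abs, Real.norm_eq_abs,
    abs_of_pos (inv_pos.2 (Real.sqrt_pos.2 hσ))]
  gcongr
  exact KS_bound (gk1_nice hd) (hB s) σ x

theorem Duh_dx {d : ℝ} (hd : 0 < d) {S : ℝ → ℝ → ℝ} {B : ℝ}
    (hS : Continuous (fun q : ℝ × ℝ => S q.1 q.2)) (hB : ∀ s x, |S s x| ≤ B) {t : ℝ} (ht : 0 ≤ t)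
    (x : ℝ) : HasDerivAt (Duh d S t) (Duh1 d S t x) x := by
  have hSs : ∀ s, Continuous (S s) := fun s => hS.comp (f := fun x => (s, x)) (by fun_prop)
  have hc : ∀ y, Continuous fun σ => KS (gk d) S σ (t - σ) y := fun y =>
    (KS_continuous (gk_nice hd) hS hB).comp (f := fun σ => (σ, t - σ, y)) (by fun_prop)
  refine (intervalIntegral.hasDerivAt_integral_of_dominated_loc_of_deriv_le (μ := volume)
    (F := fun y σ => KS (gk d) S σ (t - σ) y) (x₀ := x) (s := univ)
    (F' := fun y σ => -(√σ)⁻¹ * KS (gk1 d) S σ (t - σ) y)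
    (bound := fun σ => (B * ∫ z, |gk1 d z|) * σ ^ (-(1/2) : ℝ)) univ_mem ?_ ?_ ?_ ?_ ?_ ?_).2
  · exact Eventually.of_forall fun y => (hc y).aestronglyMeasurable
  · exact (hc x).intervalIntegrable _ _
  · exact cOn_k1 hd hS hB t x
  · refine Eventually.of_forall fun σ hσ y _ => ?_
    rw [uIoc_of_le ht] at hσ
    exact k1_bound hd hB hσ.1 _ y
  · exact (int_rpow (by norm_num)).const_mul _
  · refine Eventually.of_forall fun σ hσ y _ => ?_
    rw [uIoc_of_le ht] at hσ
    exact heat_dx hd (hSs _) (hB _) hσ.1 y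

theorem Duh1_bound {d : ℝ} (hd : 0 < d) (B T : ℝ) : ∃ M, ∀ S : ℝ → ℝ → ℝ, (∀ s x, |S s x| ≤ B) →
    ∀ t ∈ Icc 0 T, ∀ x, |Duh1 d S t x| ≤ M := by
  refine ⟨∫ σ in (0:ℝ)..T, |B * (∫ z, |gk1 d z|)| * σ ^ (-(1/2) : ℝ), fun S hB t ht x => ?_⟩
  have hi : ∀ r, IntervalIntegrable (fun σ : ℝ => |B * (∫ z, |gk1 d z|)| * σ ^ (-(1/2) : ℝ)) volume 0 r :=
    fun r => (int_rpow (by norm_num)).const_mul _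
  have h1 := intervalIntegral.norm_integral_le_of_norm_le (μ := volume) (a := 0) (b := t)
    (f := fun σ => -(√σ)⁻¹ * KS (gk1 d) S σ (t - σ) x)
    (g := fun σ => |B * (∫ z, |gk1 d z|)| * σ ^ (-(1/2) : ℝ)) ht.1
    (Eventually.of_forall fun σ hσ => (k1_bound hd hB hσ.1 _ x).trans (by
      have := Real.rpow_nonneg hσ.1.le (-(1/2) : ℝ)
      gcongr; exact le_abs_self _)) (hi t)
  refine h1.trans ?_
  apply intervalIntegral.integral_mono_interval le_rfl ht.1 ht.2 _ (hi T)
  filter_upwards [ae_restrict_mem measurableSet_Ioc] with σ hσ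
  have := Real.rpow_nonneg hσ.1.le (-(1/2) : ℝ)
  simp only [Pi.zero_apply]; positivity

theorem Duh_lip {d : ℝ} (hd : 0 < d) {B T : ℝ} : ∃ M, 0 ≤ M ∧ ∀ S : ℝ → ℝ → ℝ, (∀ s x, |S s x| ≤ B) →
    Continuous (fun q : ℝ × ℝ => S q.1 q.2) →
    ∀ t ∈ Icc 0 T, ∀ x y, |Duh d S t x - Duh d S t y| ≤ M * |x - y| := by
  obtain ⟨M, hM⟩ := Duh1_bound hd B T
  refine ⟨|M|, abs_nonneg _, fun S hB hS t ht x y => ?_⟩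
  have := Convex.norm_image_sub_le_of_norm_hasDerivWithin_le (f := Duh d S t) (f' := Duh1 d S t)
    (s := univ) (C := |M|) (x := y) (y := x)
    (fun z _ => (Duh_dx hd hS hB ht.1 z).hasDerivWithinAt)
    (fun z _ => (hM S hB t ht z).trans (le_abs_self _)) convex_univ trivial trivial
  exact this

section holder
variable {d : ℝ} {S : ℝ → ℝ → ℝ} {B C α : ℝ}

theorem Duh_dxx (hd : 0 < d)
    (hS : Continuous (fun q : ℝ × ℝ => S q.1 q.2)) (hB : ∀ s x, |S s x| ≤ B) (hα : 0 < α)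
    (hα1 : α ≤ 1) (hC : 0 ≤ C) (hH : ∀ s x y, |S s x - S s y| ≤ C * |x - y| ^ α)
    {t : ℝ} (ht : 0 ≤ t) (x : ℝ) : HasDerivAt (Duh1 d S t) (Duh2 d S t x) x := by
  have hSs : ∀ s, Continuous (S s) := fun s => hS.comp (f := fun x => (s, x)) (by fun_prop)
  obtain ⟨A, hA, hAb⟩ := heat2_holder hd
  refine (intervalIntegral.hasDerivAt_integral_of_dominated_loc_of_deriv_le (μ := volume)
    (F := fun y σ => -(√σ)⁻¹ * KS (gk1 d) S σ (t - σ) y) (x₀ := x) (s := univ)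
    (F' := fun y σ => σ⁻¹ * KS (gk2 d) S σ (t - σ) y)
    (bound := fun σ => (A * C) * σ ^ (α / 2 - 1)) univ_mem ?_ ?_ ?_ ?_ ?_ ?_).2
  · exact Eventually.of_forall fun y => cOn_k1 hd hS hB t y
  · refine ((int_rpow (α := -(1/2)) (by norm_num)).const_mul (B * ∫ z, |gk1 d z|)).mono_fun' (cOn_k1 hd hS hB t x) ?_
    filter_upwards [ae_restrict_mem measurableSet_uIoc] with σ hσ
    rw [uIoc_of_le ht] at hσ
    exact k1_bound hd hB hσ.1 _ x
  · have h1 : Continuous fun σ => KS (gk2 d) S σ (t - σ) x :=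
      (KS_continuous (gk2_nice hd) hS hB).comp (f := fun σ => (σ, t - σ, x)) (by fun_prop)
    exact (measurable_inv.mul h1.measurable).aestronglyMeasurable
  · refine Eventually.of_forall fun σ hσ y _ => ?_
    rw [uIoc_of_le ht] at hσ
    exact hAb α C B S (t - σ) hα hα1 hC (hSs _) (hB _) (hH _) σ hσ.1 y
  · exact (int_rpow (by linarith)).const_mul _
  · refine Eventually.of_forall fun σ hσ y _ => ?_
    rw [uIoc_of_le ht] at hσ
    exact heat_dxx hd (hSs _) (hB _) hσ.1 y

theorem Duh_dt (hd : 0 < d)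
    (hS : Continuous (fun q : ℝ × ℝ => S q.1 q.2)) (hB : ∀ s x, |S s x| ≤ B) (hα : 0 < α)
    (hα1 : α ≤ 1) (hC : 0 ≤ C) (hH : ∀ s x y, |S s x - S s y| ≤ C * |x - y| ^ α)
    {t : ℝ} (ht : 0 < t) (x : ℝ) :
    HasDerivAt (fun t => Duh d S t x) (S t x + d * Duh2 d S t x) t := by
  have hSs : ∀ s, Continuous (S s) := fun s => hS.comp (f := fun x => (s, x)) (by fun_prop)
  have hSx : Continuous fun s => S s x := hS.comp (f := fun s => (s, x)) (by fun_prop)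
  obtain ⟨A, hA, hAb⟩ := heat2_holder hd
  set k : ℝ → ℝ → ℝ := fun ρ s => d * (ρ⁻¹ * KS (gk2 d) S ρ s x) with hkdef
  have hK2 := KS_continuous (gk2_nice hd) hS hB
  have hk : ContinuousOn (fun q : ℝ × ℝ => k q.1 q.2) (Ioi 0 ×ˢ univ) := by
    apply ContinuousOn.mul continuousOn_const
    apply ContinuousOn.mul
    · exact continuousOn_fst.inv₀ (fun q hq => (ne_of_gt hq.1))
    · exact (hK2.comp (f := fun q : ℝ × ℝ => (q.1, q.2, x)) (by fun_prop)).continuousOn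
  have hbd : ∀ ρ > 0, ∀ s, |k ρ s| ≤ d * (A * C) * ρ ^ (α / 2 - 1) := by
    intro ρ hρ s
    rw [hkdef]; simp only
    rw [abs_mul, abs_of_pos hd, mul_assoc]
    gcongr
    exact hAb α C B S s hα hα1 hC (hSs _) (hB _) (hH _) ρ hρ x
  have hb : IntegrableOn (fun ρ : ℝ => d * (A * C) * ρ ^ (α / 2 - 1)) (Ioc 0 (t + 1)) := by
    have := ((int_rpow (t := t + 1) (show -1 < α / 2 - 1 by linarith)).const_mul (d * (A * C)))
    rwa [intervalIntegrable_iff_integrableOn_Ioc_of_le (by linarith)] at this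
  have htri := tri_deriv hk hb hbd (t := t) ⟨ht, by linarith⟩
  have hIntv : ∀ σ ≥ 0, ∀ s, IntervalIntegrable (fun ρ => k ρ s) volume 0 σ := by
    intro σ hσ s
    refine ((int_rpow (α := α / 2 - 1) (by linarith)).const_mul (d * (A * C))).mono_fun' ?_ ?_
    · rw [uIoc_of_le hσ]
      apply ContinuousOn.aestronglyMeasurable _ measurableSet_Ioc
      exact hk.comp (f := fun ρ => (ρ, s)) (by fun_prop) (fun ρ hρ => ⟨hρ.1, trivial⟩)
    · filter_upwards [ae_restrict_mem measurableSet_uIoc] with ρ hρ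
      rw [uIoc_of_le hσ] at hρ
      exact hbd ρ hρ.1 s
  have hrep : ∀ σ ≥ 0, ∀ s, KS (gk d) S σ s x = S s x + ∫ ρ in (0:ℝ)..σ, k ρ s := by
    intro σ hσ s
    have := intervalIntegral.integral_eq_sub_of_hasDerivAt_of_le hσ
      (f := fun ρ => KS (gk d) S ρ s x) (f' := fun ρ => k ρ s)
      ((KS_continuous (gk_nice hd) hS hB).comp (f := fun ρ => (ρ, s, x)) (by fun_prop)).continuousOn
      (fun ρ hρ => heat_dt hd (hSs s) (hB s) hρ.1 x) (hIntv σ hσ s)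
    rw [this, heat_zero hd]; ring
  have hD : (fun t => Duh d S t x) =ᶠ[𝓝 t] fun t =>
      (∫ s in (0:ℝ)..t, S s x) + ∫ s in (0:ℝ)..t, ∫ ρ in (0:ℝ)..(t - s), k ρ s := by
    filter_upwards [Ioi_mem_nhds ht] with r hr
    have hr0 : 0 ≤ r := le_of_lt hr
    have e1 : Duh d S r x = ∫ s in (0:ℝ)..r, KS (gk d) S (r - s) s x := by
      have := intervalIntegral.integral_comp_sub_left (a := 0) (b := r)
        (fun σ => KS (gk d) S σ (r - σ) x) r
      simp only [sub_sub_cancel, sub_self, sub_zero] at this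
      rw [Duh, ← this]
    have hcK : Continuous fun s => KS (gk d) S (r - s) s x :=
      (KS_continuous (gk_nice hd) hS hB).comp (f := fun s => (r - s, s, x)) (by fun_prop)
    have e2 : ∀ s ∈ uIcc 0 r, ∫ ρ in (0:ℝ)..(r - s), k ρ s = KS (gk d) S (r - s) s x - S s x := by
      intro s hs
      rw [uIcc_of_le hr0] at hs
      rw [hrep (r - s) (by linarith [hs.2]) s]; ring
    rw [intervalIntegral.integral_congr e2, intervalIntegral.integral_sub (hcK.intervalIntegrable _ _)
      (hSx.intervalIntegrable _ _), e1]
    ring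
  refine HasDerivAt.congr_of_eventuallyEq ?_ hD
  have h1 := intervalIntegral.integral_hasDerivAt_right (hSx.intervalIntegrable 0 t)
          hSx.stronglyMeasurable.stronglyMeasurableAtFilter hSx.continuousAt
  have h2 := h1.add htri
  refine h2.congr_deriv ?_
  rw [Duh2, ← intervalIntegral.integral_const_mul]

theorem Duh_POp (hd : 0 < d)
    (hS : Continuous (fun q : ℝ × ℝ => S q.1 q.2)) (hB : ∀ s x, |S s x| ≤ B) (hα : 0 < α)
    (hα1 : α ≤ 1) (hC : 0 ≤ C) (hH : ∀ s x y, |S s x - S s y| ≤ C * |x - y| ^ α)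
    {t : ℝ} (ht : 0 < t) (x : ℝ) : POp d (Duh d S) t x (S t x) :=
  ⟨Duh1 d S t, Duh2 d S t x, _, Eventually.of_forall fun y => Duh_dx hd hS hB ht.le y,
    Duh_dxx hd hS hB hα hα1 hC hH ht.le x, Duh_dt hd hS hB hα hα1 hC hH ht x, by ring⟩

end holder

/-- Local-in-time version: Hölder only on bounded time intervals. -/
theorem Duh_POp_loc {d : ℝ} {S : ℝ → ℝ → ℝ} {B α : ℝ} (hd : 0 < d)
    (hS : Continuous (fun q : ℝ × ℝ => S q.1 q.2)) (hB : ∀ s x, |S s x| ≤ B) (hα : 0 < α)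
    (hα1 : α ≤ 1)
    (hH : ∀ T > 0, ∃ C, 0 ≤ C ∧ ∀ s ∈ Icc 0 T, ∀ x y, |S s x - S s y| ≤ C * |x - y| ^ α)
    {t : ℝ} (ht : 0 < t) (x : ℝ) : POp d (Duh d S) t x (S t x) := by
  obtain ⟨C, hC, hCH⟩ := hH (t + 1) (by linarith)
  set c : ℝ → ℝ := fun s => max 0 (min s (t + 1)) with hc
  have hcm : ∀ s, c s ∈ Icc 0 (t + 1) := fun s =>
    ⟨le_max_left _ _, max_le (by linarith) (min_le_right _ _)⟩
  have hce : ∀ s ∈ Icc 0 (t + 1), c s = s := fun s hs => by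
    simp only [hc]; rw [min_eq_left hs.2, max_eq_right hs.1]
  have hcc : Continuous c := by fun_prop
  have h := Duh_POp (d := d) (S := fun s y => S (c s) y) (t := t) (x := x) hd
    (hS.comp (f := fun q : ℝ × ℝ => (c q.1, q.2)) (by fun_prop)) (fun s x => hB _ x) hα hα1 hC
    (fun s x y => hCH (c s) (hcm s) x y) ht
  have hE : ∀ r ∈ Ioo 0 (t + 1), ∀ y, Duh d (fun s y => S (c s) y) r y = Duh d S r y := by
    intro r hr y
    apply Duh_congr hr.1.le
    intro s hs; simp only [hce s ⟨hs.1, hs.2.trans hr.2.le⟩]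
  obtain ⟨zx, zxx, zt, h1, h2, h3, h4⟩ := h
  refine ⟨zx, zxx, zt, ?_, h2, ?_, ?_⟩
  · have : Duh d (fun s y => S (c s) y) t = Duh d S t := by
      ext y; exact hE t ⟨ht, by linarith⟩ y
    rwa [this] at h1
  · apply h3.congr_of_eventuallyEq
    filter_upwards [Ioo_mem_nhds ht (show t < t + 1 by linarith)] with r hr
    exact (hE r hr x).symm
  · rw [h4, hce t ⟨ht.le, by linarith⟩]


theorem KS_int {k : ℝ → ℝ} (hk : Nice k) {S : ℝ → ℝ → ℝ} {s : ℝ} (hS : Continuous (S s)) {B : ℝ}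
    (hB : ∀ x, |S s x| ≤ B) (τ x : ℝ) : Integrable (fun z => S s (x + √τ * z) * k z) := by
  have : Continuous fun z => S s (x + √τ * z) := hS.comp (by fun_prop)
  exact hk.integrable.bdd_mul this.aestronglyMeasurable (Eventually.of_forall fun z => hB _)

theorem KS_sub {k : ℝ → ℝ} (hk : Nice k) {S S' : ℝ → ℝ → ℝ} {s : ℝ} (hS : Continuous (S s))
    (hS' : Continuous (S' s)) {B : ℝ}
    (hB : ∀ x, |S s x| ≤ B) (hB' : ∀ x, |S' s x| ≤ B) (τ x : ℝ) :
    KS k S τ s x - KS k S' τ s x = KS k (fun s x => S s x - S' s x) τ s x := by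
  unfold KS
  rw [← integral_sub (KS_int hk hS hB τ x) (KS_int hk hS' hB' τ x)]
  congr 1; ext z; ring

theorem Duh_diff {d : ℝ} (hd : 0 < d) {S S' : ℝ → ℝ → ℝ} {B : ℝ}
    (hS : Continuous (fun q : ℝ × ℝ => S q.1 q.2)) (hS' : Continuous (fun q : ℝ × ℝ => S' q.1 q.2))
    (hB : ∀ s x, |S s x| ≤ B) (hB' : ∀ s x, |S' s x| ≤ B) {l G : ℝ} (hl : 0 < l) (hG0 : 0 ≤ G)
    (hG : ∀ s ≥ 0, ∀ x, |S s x - S' s x| ≤ G * Real.exp (l * s)) {t : ℝ} (ht : 0 ≤ t) (x : ℝ) :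
    |Duh d S t x - Duh d S' t x| ≤ G / l * Real.exp (l * t) := by
  have hSs : ∀ s, Continuous (S s) := fun s => hS.comp (f := fun x => (s, x)) (by fun_prop)
  have hSs' : ∀ s, Continuous (S' s) := fun s => hS'.comp (f := fun x => (s, x)) (by fun_prop)
  have hc : Continuous fun σ => KS (gk d) S σ (t - σ) x :=
    (KS_continuous (gk_nice hd) hS hB).comp (f := fun σ => (σ, t - σ, x)) (by fun_prop)
  have hc' : Continuous fun σ => KS (gk d) S' σ (t - σ) x :=
    (KS_continuous (gk_nice hd) hS' hB').comp (f := fun σ => (σ, t - σ, x)) (by fun_prop)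
  unfold Duh
  rw [← intervalIntegral.integral_sub (hc.intervalIntegrable _ _) (hc'.intervalIntegrable _ _)]
  have hcE : Continuous fun σ : ℝ => G * Real.exp (l * (t - σ)) := by fun_prop
  have h1 := intervalIntegral.norm_integral_le_of_norm_le (μ := volume) (a := 0) (b := t)
    (f := fun σ => KS (gk d) S σ (t - σ) x - KS (gk d) S' σ (t - σ) x)
    (g := fun σ => G * Real.exp (l * (t - σ))) ht
    (Eventually.of_forall fun σ hσ => by
      rw [KS_sub (gk_nice hd) (hSs _) (hSs' _) (hB _) (hB' _)]
      exact heat_abs_le hd (S := fun s x => S s x - S' s x)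
        (hG (t - σ) (by linarith [hσ.2])) σ x) (hcE.intervalIntegrable _ _)
  refine h1.trans ?_
  have h2 : ∫ σ in (0:ℝ)..t, G * Real.exp (l * (t - σ)) =
      (-(G / l) * Real.exp (l * (t - t))) - (-(G / l) * Real.exp (l * (t - 0))) := by
    apply intervalIntegral.integral_eq_sub_of_hasDerivAt _ (hcE.intervalIntegrable _ _)
      (f := fun σ => -(G / l) * Real.exp (l * (t - σ)))
    intro σ _
    have := (((((hasDerivAt_id σ).const_sub t).const_mul l).exp).const_mul (-(G / l)))
    refine this.congr_deriv ?_
    simp only [id]; field_simp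
  rw [h2]
  simp only [sub_self, mul_zero, Real.exp_zero, sub_zero]
  have : 0 ≤ G / l := by positivity
  linarith

theorem exists_fixed {d : ℝ} (hd : 0 < d) {F : ℝ → ℝ → ℝ → ℝ} {B Λ : ℝ}
    (hF : Continuous (fun q : ℝ × ℝ × ℝ => F q.1 q.2.1 q.2.2)) (hB : ∀ t x u, |F t x u| ≤ B)
    (hΛ : 0 ≤ Λ) (hL : ∀ t x u v, |F t x u - F t x v| ≤ Λ * |u - v|) :
    ∃ w : ℝ → ℝ → ℝ, Continuous (fun q : ℝ × ℝ => w q.1 q.2) ∧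
      ∀ t x, w t x = Duh d (fun s y => F s y (w s y)) (max t 0) x := by
  set l : ℝ := 2 * Λ + 1 with hl
  have hl0 : 0 < l := by positivity
  have hB0 : 0 ≤ B := (abs_nonneg _).trans (hB 0 0 0)
  set S : (BoundedContinuousFunction (ℝ × ℝ) ℝ) → ℝ → ℝ → ℝ := fun a s y =>
    F s y (Real.exp (l * max s 0) * a (s, y)) with hSdef
  have hSc : ∀ a, Continuous (fun q : ℝ × ℝ => S a q.1 q.2) := fun a => by
    have ha := a.continuous
    exact hF.comp (f := fun q : ℝ × ℝ => (q.1, q.2, Real.exp (l * max q.1 0) * a (q.1, q.2))) (by fun_prop)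
  have hSB : ∀ a s x, |S a s x| ≤ B := fun a s x => hB _ _ _
  set Φ : (BoundedContinuousFunction (ℝ × ℝ) ℝ) → (BoundedContinuousFunction (ℝ × ℝ) ℝ) := fun a =>
    BoundedContinuousFunction.ofNormedAddCommGroup
      (fun q : ℝ × ℝ => Real.exp (-(l * max q.1 0)) * Duh d (S a) (max q.1 0) q.2)
      (by
        have := (Duh_continuous hd (hSc a) (hSB a)).comp (f := fun q : ℝ × ℝ => (max q.1 0, q.2)) (by fun_prop)
        have h2 : Continuous fun q : ℝ × ℝ => Real.exp (-(l * max q.1 0)) := by fun_prop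
        exact h2.mul this)
      (B / l) (by
        intro q
        set t := max q.1 0
        have ht : 0 ≤ t := le_max_right _ _
        rw [norm_mul, Real.norm_eq_abs, Real.norm_eq_abs, abs_of_pos (Real.exp_pos _)]
        have h1 := Duh_bound hd ht (hSB a) q.2
        have h2 := Real.add_one_le_exp (l * t)
        rw [Real.exp_neg, inv_mul_le_iff₀ (Real.exp_pos _)]
        refine h1.trans ?_
        rw [mul_div_assoc', le_div_iff₀ hl0]
        nlinarith) with hΦ
  have hcontr : ContractingWith (1/2 : NNReal) Φ := by
    refine ⟨by
      have : (1/2 : NNReal) < 1 := by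
        rw [← NNReal.coe_lt_coe]; push_cast; norm_num
      exact this, ?_⟩
    apply LipschitzWith.of_dist_le_mul
    intro a b
    rw [BoundedContinuousFunction.dist_le (by positivity)]
    intro q
    set t := max q.1 0 with ht'
    have ht : 0 ≤ t := le_max_right _ _
    have hd1 := Duh_diff hd (hSc a) (hSc b) (hSB a) (hSB b) hl0 (G := Λ * dist a b) (by positivity) (by
      intro s hs x
      refine (hL _ _ _ _).trans ?_
      rw [max_eq_left hs, ← mul_sub, abs_mul, abs_of_pos (Real.exp_pos _)]
      have := BoundedContinuousFunction.dist_coe_le_dist (f := a) (g := b) (s, x)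
      rw [Real.dist_eq] at this
      have h3 := Real.exp_pos (l * s)
      calc Λ * (Real.exp (l * s) * |a (s, x) - b (s, x)|) ≤ Λ * (Real.exp (l * s) * dist a b) := by gcongr
        _ = _ := by ring) ht q.2
    change dist (Real.exp (-(l * t)) * Duh d (S a) t q.2) (Real.exp (-(l * t)) * Duh d (S b) t q.2) ≤ _
    rw [Real.dist_eq, ← mul_sub, abs_mul, abs_of_pos (Real.exp_pos _), Real.exp_neg,
      inv_mul_le_iff₀ (Real.exp_pos _)]
    refine hd1.trans ?_
    rw [mul_comm]
    gcongr
    rw [div_le_iff₀ hl0]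
    push_cast
    have := dist_nonneg (x := a) (y := b)
    rw [hl]; nlinarith
  set a := hcontr.fixedPoint with hadef
  have ha : Φ a = a := hcontr.fixedPoint_isFixedPt
  refine ⟨fun t x => Real.exp (l * max t 0) * a (t, x), ?_, ?_⟩
  · have ha := a.continuous
    fun_prop
  · intro t x
    have h1 : a (t, x) = Real.exp (-(l * max t 0)) * Duh d (S a) (max t 0) x := by
      conv_lhs => rw [← ha]
      rfl
    change Real.exp (l * max t 0) * a (t, x) = Duh d (S a) (max t 0) x
    rw [h1, ← mul_assoc, ← Real.exp_add]; simp

theorem exists_mild {d : ℝ} (hd : 0 < d) {F : ℝ → ℝ → ℝ → ℝ} {B Λ C α : ℝ}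
    (hF : Continuous (fun q : ℝ × ℝ × ℝ => F q.1 q.2.1 q.2.2)) (hB : ∀ t x u, |F t x u| ≤ B)
    (hΛ : 0 ≤ Λ) (hL : ∀ t x u v, |F t x u - F t x v| ≤ Λ * |u - v|)
    (hα : 0 < α) (hα1 : α ≤ 1) (hC : 0 ≤ C)
    (hH : ∀ t x y u, |F t x u - F t y u| ≤ C * |x - y| ^ α) :
    ∃ w : ℝ → ℝ → ℝ, Continuous (fun q : ℝ × ℝ => w q.1 q.2) ∧ (∀ x, w 0 x = 0) ∧
      (∀ t ≥ 0, ∀ x, |w t x| ≤ B * t) ∧ ∀ t > 0, ∀ x, POp d w t x (F t x (w t x)) := by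
  obtain ⟨w, hwc, hw⟩ := exists_fixed hd hF hB hΛ hL
  have hB0 : 0 ≤ B := (abs_nonneg _).trans (hB 0 0 0)
  set S : ℝ → ℝ → ℝ := fun s y => F s y (w s y) with hS
  have hSc : Continuous (fun q : ℝ × ℝ => S q.1 q.2) :=
    hF.comp (f := fun q : ℝ × ℝ => (q.1, q.2, w q.1 q.2)) (by fun_prop)
  have hSB : ∀ s x, |S s x| ≤ B := fun s x => hB _ _ _
  have hwp : ∀ t ≥ 0, ∀ x, w t x = Duh d S t x := fun t ht x => by
    have := hw t x; rwa [max_eq_left ht] at this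
  refine ⟨w, hwc, fun x => by rw [hwp 0 le_rfl, Duh_zero], fun t ht x => ?_, fun t ht x => ?_⟩
  · rw [hwp t ht]; exact Duh_bound hd ht hSB x
  · have hP := Duh_POp_loc (d := d) (S := S) (t := t) (α := α) hd hSc hSB hα hα1 (by
      intro T hT
      obtain ⟨M, hM, hMl⟩ := Duh_lip hd (B := B) (T := T)
      refine ⟨C + Λ * M + 2 * B, by positivity, fun s hs x y => ?_⟩
      have hr : 0 ≤ |x - y| ^ α := Real.rpow_nonneg (abs_nonneg _) _
      by_cases h1 : |x - y| ≤ 1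
      · have h2 : |x - y| ≤ |x - y| ^ α := by
          have := Real.rpow_le_rpow_of_exponent_ge' (abs_nonneg (x - y)) h1 hα.le hα1
          rwa [Real.rpow_one] at this
        have h3 : |S s x - S s y| ≤ |F s x (w s x) - F s y (w s x)| + |F s y (w s x) - F s y (w s y)| :=
          abs_sub_le _ _ _
        have h4 := hH s x y (w s x)
        have h5 := hL s y (w s x) (w s y)
        have h6 : |w s x - w s y| ≤ M * |x - y| := by
          rw [hwp s hs.1, hwp s hs.1]; exact hMl S hSB hSc s hs x y
        have h7 : Λ * |w s x - w s y| ≤ Λ * (M * |x - y| ^ α) := by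
          gcongr; exact h6.trans (by gcongr)
        nlinarith
      · have h2 : 1 ≤ |x - y| ^ α := Real.one_le_rpow (not_le.1 h1).le hα.le
        have h3 := abs_sub (S s x) (S s y)
        have h4 := hSB s x
        have h5 := hSB s y
        have h6 : 0 ≤ C + Λ * M := by positivity
        nlinarith) ht x
    obtain ⟨zx, zxx, zt, h1, h2, h3, h4⟩ := hP
    refine ⟨zx, zxx, zt, ?_, h2, ?_, h4⟩
    · have : Duh d S t = w t := by ext y; exact (hwp t ht.le y).symm
      rwa [this] at h1
    · apply h3.congr_of_eventuallyEq
      filter_upwards [Ioi_mem_nhds ht] with r hr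
      exact hwp r (le_of_lt hr) x


theorem mp0 {d : ℝ} (hd : 0 < d) (z : ℝ → ℝ → ℝ)
    (hc : Continuous (fun q : ℝ × ℝ => z q.1 q.2)) (hb : ∃ B, ∀ t ≥ 0, ∀ x, z t x ≤ B)
    (h0 : ∀ x, z 0 x ≤ 0) (hz : ∀ t > 0, ∀ x, 0 < z t x → ∃ r, POp d z t x r ∧ r ≤ 0) :
    ∀ t ≥ 0, ∀ x, z t x ≤ 0 := by
  intro t ht
  obtain ⟨B, hB⟩ := hb
  exact max_principle (C := 0) (T := t) hd z hc.continuousOn ⟨B, fun s hs x => hB s hs.1 x⟩ h0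
    (fun s hs x h => by
      obtain ⟨r, h1, h2⟩ := hz s hs.1 x h
      exact ⟨r, h1, by simpa using h2⟩) t ⟨ht, le_rfl⟩

/-- Bounded solution of `z_t = d z_xx - q z`. -/
structure LinSol (d : ℝ) (q D : ℝ → ℝ → ℝ) : Prop where
  cont : Continuous (fun r : ℝ × ℝ => D r.1 r.2)
  bdd : ∃ B, ∀ t ≥ (0:ℝ), ∀ x, |D t x| ≤ B
  pop : ∀ t > (0:ℝ), ∀ x, POp d D t x (-(q t x) * D t x)

theorem LinSol.cmul {d : ℝ} {q D : ℝ → ℝ → ℝ} (h : LinSol d q D) (c : ℝ) :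
    LinSol d q (fun t x => c * D t x) := by
  refine ⟨continuous_const.mul h.cont, ?_, fun t ht x => ?_⟩
  · obtain ⟨B, hB⟩ := h.bdd
    refine ⟨|c| * B, fun t ht x => ?_⟩
    rw [abs_mul]; gcongr; exact hB t ht x
  · have := (h.pop t ht x).const_mul c
    convert this using 1; ring

theorem LinSol.add {d : ℝ} {q D E : ℝ → ℝ → ℝ} (h : LinSol d q D) (k : LinSol d q E) :
    LinSol d q (fun t x => D t x + E t x) := by
  refine ⟨h.cont.add k.cont, ?_, fun t ht x => ?_⟩
  · obtain ⟨B, hB⟩ := h.bdd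
    obtain ⟨B', hB'⟩ := k.bdd
    exact ⟨B + B', fun t ht x => (abs_add_le _ _).trans (add_le_add (hB t ht x) (hB' t ht x))⟩
  · have := (h.pop t ht x).add (k.pop t ht x)
    convert this using 1; ring

theorem LinSol.sub {d : ℝ} {q D E : ℝ → ℝ → ℝ} (h : LinSol d q D) (k : LinSol d q E) :
    LinSol d q (fun t x => D t x - E t x) := by
  have := h.add (k.cmul (-1))
  simpa [sub_eq_add_neg] using this

theorem LinSol.shift {d : ℝ} {q D : ℝ → ℝ → ℝ} (h : LinSol d q D) {a : ℝ} (ha : 0 ≤ a) (b : ℝ) :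
    LinSol d (fun t x => q (a + t) (b + x)) (fun t x => D (a + t) (b + x)) := by
  refine ⟨h.cont.comp (f := fun r : ℝ × ℝ => (a + r.1, b + r.2)) (by fun_prop), ?_, fun t ht x => ?_⟩
  · obtain ⟨B, hB⟩ := h.bdd
    exact ⟨B, fun t ht x => hB _ (by linarith) _⟩
  · exact (h.pop (a + t) (by linarith) (b + x)).shift a b

theorem LinSol.tshift {d : ℝ} {q D : ℝ → ℝ → ℝ} (h : LinSol d q D) {a : ℝ} (ha : 0 ≤ a) :
    LinSol d (fun t x => q (a + t) x) (fun t x => D (a + t) x) := by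
  simpa using h.shift ha 0

theorem LinSol.le_zero {d : ℝ} (hd : 0 < d) {q D : ℝ → ℝ → ℝ} (h : LinSol d q D)
    (hq : ∀ t x, 0 ≤ q t x) (h0 : ∀ x, D 0 x ≤ 0) : ∀ t ≥ 0, ∀ x, D t x ≤ 0 := by
  obtain ⟨B, hB⟩ := h.bdd
  refine mp0 hd D h.cont ⟨B, fun t ht x => (le_abs_self _).trans (hB t ht x)⟩ h0 fun t ht x hz =>
    ⟨_, h.pop t ht x, ?_⟩
  have := hq t x
  nlinarith [mul_nonneg this hz.le]

theorem LinSol.mono {d : ℝ} (hd : 0 < d) {q D E : ℝ → ℝ → ℝ} (h : LinSol d q D) (k : LinSol d q E)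
    (hq : ∀ t x, 0 ≤ q t x) (h0 : ∀ x, D 0 x ≤ E 0 x) : ∀ t ≥ 0, ∀ x, D t x ≤ E t x := by
  intro t ht x
  have := (h.sub k).le_zero hd hq (fun x => by linarith [h0 x]) t ht x
  linarith

theorem LinSol.uniq {d : ℝ} (hd : 0 < d) {q D E : ℝ → ℝ → ℝ} (h : LinSol d q D) (k : LinSol d q E)
    (hq : ∀ t x, 0 ≤ q t x) (h0 : ∀ x, D 0 x = E 0 x) : ∀ t ≥ 0, ∀ x, D t x = E t x :=
  fun t ht x => le_antisymm (h.mono hd k hq (fun x => (h0 x).le) t ht x)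
    (k.mono hd h hq (fun x => (h0 x).ge) t ht x)

theorem LinSol.nonneg {d : ℝ} (hd : 0 < d) {q D : ℝ → ℝ → ℝ} (h : LinSol d q D)
    (hq : ∀ t x, 0 ≤ q t x) (h0 : ∀ x, 0 ≤ D 0 x) : ∀ t ≥ 0, ∀ x, 0 ≤ D t x := by
  intro t ht x
  have := (h.cmul (-1)).le_zero hd hq (fun x => by linarith [h0 x]) t ht x
  linarith

theorem lin_exists {d : ℝ} (hd : 0 < d) {q : ℝ → ℝ → ℝ} {Q C : ℝ}
    (hqc : Continuous (fun r : ℝ × ℝ => q r.1 r.2)) (hq : ∀ t x, 0 ≤ q t x) (hQ : ∀ t x, q t x ≤ Q)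
    (hC : ∀ t x y, |q t x - q t y| ≤ C * |x - y|) (θ : ℝ) :
    ∃ D, LinSol d q D ∧ (∀ x, D 0 x = Real.cos (θ * x)) ∧ ∀ t ≥ 0, ∀ x, |D t x| ≤ 1 := by
  have hQ0 : 0 ≤ Q := (hq 0 0).trans (hQ 0 0)
  have hC0 : 0 ≤ C := by
    have := (abs_nonneg _).trans (hC 0 1 0); simpa using this
  set cl : ℝ → ℝ := fun c => max (-1) (min c 1) with hcl
  have cl1 : ∀ c, |cl c| ≤ 1 := fun c => by
    rw [abs_le]; exact ⟨le_max_left _ _, max_le (by norm_num) (min_le_right _ _)⟩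
  have cll : ∀ a b, |cl a - cl b| ≤ |a - b| := fun a b => by
    simp only [hcl]
    have h1 := abs_max_sub_max_le_abs (min a 1) (min b 1) (-1)
    have h2 := abs_min_sub_min_le_max a 1 b 1
    rw [max_comm (-1), max_comm (-1)]
    refine h1.trans (h2.trans ?_)
    simp
  have clc : Continuous cl := by fun_prop
  have cosl : ∀ x y, |Real.cos (θ * x) - Real.cos (θ * y)| ≤ |θ| * |x - y| := fun x y => by
    have := Real.abs_cos_sub_cos_le (θ * x) (θ * y)
    rwa [← mul_sub, abs_mul] at this
  set F : ℝ → ℝ → ℝ → ℝ := fun t x w =>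
    -(d * θ ^ 2 * Real.cos (θ * x)) - q t x * cl (Real.cos (θ * x) + w) with hF
  obtain ⟨w, hwc, hw0, hwb, hwp⟩ := exists_mild (F := F) (B := d * θ ^ 2 + Q) (Λ := Q) (α := 1)
    (C := d * θ ^ 2 * |θ| + (C + Q * |θ|)) hd
    (by
      have : Continuous fun r : ℝ × ℝ × ℝ => q r.1 r.2.1 :=
        hqc.comp (f := fun r : ℝ × ℝ × ℝ => (r.1, r.2.1)) (by fun_prop)
      fun_prop)
    (by
      intro t x u
      refine (abs_sub _ _).trans ?_
      rw [abs_neg, abs_mul, abs_mul (q t x), abs_of_nonneg (by positivity : 0 ≤ d * θ ^ 2), abs_of_nonneg (hq t x)]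
      have h1 := Real.abs_cos_le_one (θ * x)
      have h2 := cl1 (Real.cos (θ * x) + u)
      have h3 := hQ t x
      have h4 := hq t x
      have h5 : d * θ ^ 2 * |Real.cos (θ * x)| ≤ d * θ ^ 2 * 1 := by gcongr
      have h6 : q t x * |cl (Real.cos (θ * x) + u)| ≤ Q * 1 := by gcongr
      linarith) hQ0
    (by
      intro t x u v
      have e : F t x u - F t x v = - (q t x * (cl (Real.cos (θ * x) + u) - cl (Real.cos (θ * x) + v))) := by
        simp only [hF]; ring
      rw [e, abs_neg, abs_mul, abs_of_nonneg (hq t x)]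
      have := cll (Real.cos (θ * x) + u) (Real.cos (θ * x) + v)
      rw [add_sub_add_left_eq_sub] at this
      gcongr
      exact hQ t x) one_pos le_rfl (by positivity)
    (by
      intro t x y u
      rw [Real.rpow_one]
      have e : F t x u - F t y u = -(d * θ ^ 2 * (Real.cos (θ * x) - Real.cos (θ * y)))
          + (-((q t x - q t y) * cl (Real.cos (θ * x) + u))
          + -(q t y * (cl (Real.cos (θ * x) + u) - cl (Real.cos (θ * y) + u)))) := by
        simp only [hF]; ring
      rw [e]
      refine (abs_add_le _ _).trans ?_
      have h0 := abs_add_le (-((q t x - q t y) * cl (Real.cos (θ * x) + u)))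
        (-(q t y * (cl (Real.cos (θ * x) + u) - cl (Real.cos (θ * y) + u))))
      rw [abs_neg, abs_neg, abs_mul, abs_mul, abs_of_nonneg (hq t y)] at h0
      rw [abs_neg, abs_mul, abs_of_nonneg (by positivity : 0 ≤ d * θ ^ 2)]
      have h1 := cosl x y
      have h2 := cll (Real.cos (θ * x) + u) (Real.cos (θ * y) + u)
      rw [add_sub_add_right_eq_sub] at h2
      have h3 : |q t x - q t y| * |cl (Real.cos (θ * x) + u)| ≤ C * |x - y| * 1 := by
        gcongr
        · exact hC t x y
        · exact cl1 _
      have h4 : q t y * |cl (Real.cos (θ * x) + u) - cl (Real.cos (θ * y) + u)| ≤ Q * (|θ| * |x - y|) := by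
        have := hQ t y
        gcongr
        exact h2.trans h1
      have h5 : d * θ ^ 2 * |Real.cos (θ * x) - Real.cos (θ * y)| ≤ d * θ ^ 2 * (|θ| * |x - y|) := by gcongr
      linarith)
  set D : ℝ → ℝ → ℝ := fun t x => Real.cos (θ * x) + w t x with hD
  have hDc : Continuous (fun r : ℝ × ℝ => D r.1 r.2) := by fun_prop
  have hDp : ∀ t > 0, ∀ x, POp d D t x (-(q t x) * cl (D t x)) := by
    intro t ht x
    have h1 : ∀ y, HasDerivAt (fun x => Real.cos (θ * x)) (-(θ * Real.sin (θ * y))) y := fun y => by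
      have := ((hasDerivAt_id y).const_mul θ).cos
      exact this.congr_deriv (by simp only [id]; ring)
    have h2 : HasDerivAt (fun y => -(θ * Real.sin (θ * y))) (-(θ ^ 2 * Real.cos (θ * x))) x := by
      have := (((hasDerivAt_id x).const_mul θ).sin.const_mul θ).neg
      exact this.congr_deriv (by simp only [id]; ring)
    have := (POp.space (d := d) (t := t) h1 h2).add (hwp t ht x)
    convert this using 1
    simp only [hF, hD]; ring
  have hDb : ∀ T, ∃ B, ∀ t ∈ Icc 0 T, ∀ x, |D t x| ≤ B := fun T => by
    refine ⟨1 + (d * θ ^ 2 + Q) * T, fun t ht x => (abs_add_le _ _).trans (add_le_add (Real.abs_cos_le_one _) ((hwb t ht.1 x).trans ?_))⟩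
    have := ht.2
    gcongr
  have hD0 : ∀ x, D 0 x = Real.cos (θ * x) := fun x => by simp [hD, hw0]
  have hD1 : ∀ t ≥ 0, ∀ x, |D t x| ≤ 1 := by
    intro t ht x
    obtain ⟨B, hB⟩ := hDb t
    rw [abs_le]
    constructor
    · have := max_principle (C := 0) (T := t) hd (fun t x => - D t x - 1) (by fun_prop)
        ⟨B, fun s hs x => by have := abs_le.1 (hB s hs x); linarith [this.1]⟩
        (fun x => by rw [hD0]; linarith [Real.neg_one_le_cos (θ * x)])
        (fun s hs x hz => ⟨_, (hDp s hs.1 x).neg.sub (POp.const 1), by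
          have hlt : D s x < -1 := by linarith
          have : cl (D s x) = -1 := by
            simp only [hcl]; rw [min_eq_left (by linarith), max_eq_left hlt.le]
          rw [this]; linarith [hq s x]⟩) t ⟨ht, le_rfl⟩ x
      linarith
    · have := max_principle (C := 0) (T := t) hd (fun t x => D t x - 1) (by fun_prop)
        ⟨B, fun s hs x => by have := abs_le.1 (hB s hs x); linarith [this.2]⟩
        (fun x => by rw [hD0]; linarith [Real.cos_le_one (θ * x)])
        (fun s hs x hz => ⟨_, (hDp s hs.1 x).sub (POp.const 1), by
          have hlt : 1 < D s x := by linarith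
          have : cl (D s x) = 1 := by
            simp only [hcl]; rw [min_eq_right (by linarith), max_eq_right (by norm_num)]
          rw [this]; linarith [hq s x]⟩) t ⟨ht, le_rfl⟩ x
      linarith
  refine ⟨D, ⟨hDc, ⟨1, hD1⟩, fun t ht x => ?_⟩, hD0, hD1⟩
  have := hDp t ht x
  have e : cl (D t x) = D t x := by
    have := abs_le.1 (hD1 t ht.le x)
    simp only [hcl]; rw [min_eq_left this.2, max_eq_right this.1]
  rwa [e] at this


theorem heat_nonneg {d : ℝ} {φ : ℝ → ℝ} (h : ∀ x, 0 ≤ φ x) (τ x : ℝ) :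
    0 ≤ KS (gk d) (fun _ => φ) τ 0 x :=
  integral_nonneg fun z => mul_nonneg (h _) (gk_nonneg d z)

theorem LinSol.slice {d : ℝ} {q D : ℝ → ℝ → ℝ} (h : LinSol d q D) (s : ℝ) : Continuous (D s) :=
  h.cont.comp (f := fun x => (s, x)) (by fun_prop)

theorem LinSol.heat_cont {d : ℝ} (hd : 0 < d) {q D : ℝ → ℝ → ℝ} (h : LinSol d q D) :
    Continuous fun r : ℝ × ℝ => KS (gk d) (fun _ => D 0) r.1 0 r.2 := by
  obtain ⟨B, hB⟩ := h.bdd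
  have := KS_continuous (gk_nice hd) (S := fun _ => D 0) (B := B)
    ((h.slice 0).comp (continuous_snd (X := ℝ))) (fun s x => hB 0 le_rfl x)
  exact this.comp (f := fun r : ℝ × ℝ => (r.1, 0, r.2)) (by fun_prop)

theorem LinSol.le_heat {d : ℝ} (hd : 0 < d) {q D : ℝ → ℝ → ℝ} (h : LinSol d q D)
    (hq : ∀ t x, 0 ≤ q t x) (h0 : ∀ x, 0 ≤ D 0 x) :
    ∀ t ≥ 0, ∀ x, D t x ≤ KS (gk d) (fun _ => D 0) t 0 x := by
  obtain ⟨B, hB⟩ := h.bdd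
  intro t ht x
  have := mp0 hd (fun t x => D t x - KS (gk d) (fun _ => D 0) t 0 x) (h.cont.sub (h.heat_cont hd))
    ⟨B + B, fun t ht x => by
      have h1 := abs_le.1 (hB t ht x)
      have h2 := abs_le.1 (heat_abs_le hd (S := fun _ => D 0) (s := 0) (hB 0 le_rfl) t x)
      linarith [h1.2, h2.1]⟩ (fun x => by simp [heat_zero hd]) (fun t ht x _ =>
      ⟨_, (h.pop t ht x).sub (heat_POp hd (h.slice 0) (hB 0 le_rfl) ht x), by
        have := mul_nonneg (hq t x) (h.nonneg hd hq h0 t ht.le x)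
        linarith⟩) t ht x
  linarith

theorem LinSol.ge_heat {d : ℝ} (hd : 0 < d) {q D : ℝ → ℝ → ℝ} {Q : ℝ} (h : LinSol d q D)
    (hq : ∀ t x, 0 ≤ q t x) (hQ : ∀ t x, q t x ≤ Q) (h0 : ∀ x, 0 ≤ D 0 x) :
    ∀ t ≥ 0, ∀ x, Real.exp (-(Q * t)) * KS (gk d) (fun _ => D 0) t 0 x ≤ D t x := by
  obtain ⟨B, hB⟩ := h.bdd
  have hQ0 : 0 ≤ Q := (hq 0 0).trans (hQ 0 0)
  have hB0 : 0 ≤ B := (abs_nonneg _).trans (hB 0 le_rfl 0)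
  intro t ht x
  have hec : Continuous fun r : ℝ × ℝ => Real.exp (-(Q * r.1)) := by fun_prop
  have := mp0 hd (fun t x => Real.exp (-(Q * t)) * KS (gk d) (fun _ => D 0) t 0 x - D t x)
    ((hec.mul (h.heat_cont hd)).sub h.cont)
    ⟨B + B, fun t ht x => by
      have h1 := abs_le.1 (hB t ht x)
      have h2 := abs_le.1 (heat_abs_le hd (S := fun _ => D 0) (s := 0) (hB 0 le_rfl) t x)
      have h3 : Real.exp (-(Q * t)) ≤ 1 := Real.exp_le_one_iff.2 (by have := mul_nonneg hQ0 ht; linarith)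
      have h4 : Real.exp (-(Q * t)) * KS (gk d) (fun _ => D 0) t 0 x ≤ 1 * B := by
        have := heat_nonneg (d := d) h0 t x
        gcongr; exact h2.2
      linarith [h1.1]⟩ (fun x => by simp [heat_zero hd]) (fun t ht x hz => by
      have he : HasDerivAt (fun t => Real.exp (-(Q * t))) (-Q * Real.exp (-(Q * t))) t := by
        have := ((hasDerivAt_id t).const_mul Q).neg.exp
        exact this.congr_deriv (by simp only [id, Pi.neg_apply]; ring)
      refine ⟨_, ((heat_POp hd (h.slice 0) (hB 0 le_rfl) ht x).mul_time he).sub (h.pop t ht x), ?_⟩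
      have h1 := h.nonneg hd hq h0 t ht.le x
      have h2 := hQ t x
      have h3 : q t x * D t x ≤ Q * D t x := by gcongr
      have h4 : Q * D t x ≤ Q * (Real.exp (-(Q * t)) * KS (gk d) (fun _ => D 0) t 0 x) := by
        gcongr; linarith
      nlinarith) t ht x
  linarith

theorem gauss_harnack {d : ℝ} (hd : 0 < d) {φ : ℝ → ℝ} (hφ : Continuous φ) {B : ℝ}
    (hB : ∀ x, |φ x| ≤ B) (h0 : ∀ x, 0 ≤ φ x) {τ W w : ℝ} (hτ : 0 < τ) (hw : |w| ≤ W) (x : ℝ) :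
    (Real.exp (-(W ^ 2 / (2 * d * τ))) / √2) * KS (gk d) (fun _ => φ) (τ / 2) 0 (x + w) ≤
      KS (gk d) (fun _ => φ) τ 0 x := by
  rw [KS_kernel _ _ hτ, KS_kernel _ _ (half_pos hτ), ← integral_const_mul]
  apply integral_mono
  · exact (integrable_kernel (gk_nice hd) hφ hB (half_pos hτ) (x + w)).const_mul _
  · exact integrable_kernel (gk_nice hd) hφ hB hτ x
  intro y
  simp only
  have hs : 0 < √τ := Real.sqrt_pos.2 hτ
  have h2 : 0 < √2 := Real.sqrt_pos.2 (by norm_num)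
  have e1 : √(τ / 2) = √τ / √2 := Real.sqrt_div hτ.le 2
  have hk : Real.exp (-(W ^ 2 / (2 * d * τ))) * gk d ((y - (x + w)) / √(τ / 2)) ≤ gk d ((y - x) / √τ) := by
    unfold gk
    rw [← mul_div_assoc, ← Real.exp_add]
    apply div_le_div_of_nonneg_right _ (Real.sqrt_nonneg _)
    apply Real.exp_le_exp.2
    rw [div_pow, div_pow, Real.sq_sqrt hτ.le, Real.sq_sqrt (half_pos hτ).le]
    have hw2 : w ^ 2 ≤ W ^ 2 := sq_le_sq' (by linarith [(abs_le.1 hw).1]) (abs_le.1 hw).2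
    have : (y - x) ^ 2 ≤ 2 * (y - (x + w)) ^ 2 + 2 * W ^ 2 := by
      nlinarith [sq_nonneg (y - x - 2 * w)]
    have h4 : (y - x) ^ 2 / (4 * d * τ) ≤ (2 * (y - (x + w)) ^ 2 + 2 * W ^ 2) / (4 * d * τ) := by gcongr
    have e5 : -(W ^ 2 / (2 * d * τ)) + -(1 / (4 * d)) * ((y - (x + w)) ^ 2 / (τ / 2)) =
        -((2 * (y - (x + w)) ^ 2 + 2 * W ^ 2) / (4 * d * τ)) := by field_simp; ring
    have e6 : -(1 / (4 * d)) * ((y - x) ^ 2 / τ) = -((y - x) ^ 2 / (4 * d * τ)) := by field_simp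
    rw [e5, e6]; linarith
  have e7 : Real.exp (-(W ^ 2 / (2 * d * τ))) / √2 * (φ y * ((√(τ / 2))⁻¹ * gk d ((y - (x + w)) / √(τ / 2))))
      = φ y * ((√τ)⁻¹ * (Real.exp (-(W ^ 2 / (2 * d * τ))) * gk d ((y - (x + w)) / √(τ / 2)))) := by
    have : (√(τ / 2))⁻¹ = √2 * (√τ)⁻¹ := by rw [e1, inv_div]; rfl
    rw [this]; field_simp
  rw [e7]
  have := h0 y
  gcongr

/-- Harnack constant. -/
def hc (d Q τ W : ℝ) : ℝ := Real.exp (-(Q * τ)) * (Real.exp (-(W ^ 2 / (2 * d * τ))) / √2)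

theorem hc_pos (d Q τ W : ℝ) : 0 < hc d Q τ W := by unfold hc; positivity

theorem LinSol.harnack {d : ℝ} (hd : 0 < d) {q D : ℝ → ℝ → ℝ} {Q : ℝ} (h : LinSol d q D)
    (hq : ∀ t x, 0 ≤ q t x) (hQ : ∀ t x, q t x ≤ Q) (h0 : ∀ x, 0 ≤ D 0 x) {τ W w : ℝ} (hτ : 0 < τ)
    (hw : |w| ≤ W) (x : ℝ) : hc d Q τ W * D (τ / 2) (x + w) ≤ D τ x := by
  obtain ⟨B, hB⟩ := h.bdd
  have h1 := h.ge_heat hd hq hQ h0 τ hτ.le x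
  have h2 := gauss_harnack hd (h.slice 0) (hB 0 le_rfl) h0 hτ hw x
  have h3 := h.le_heat hd hq h0 (τ / 2) (half_pos hτ).le (x + w)
  unfold hc
  refine le_trans ?_ h1
  rw [mul_assoc]
  have h5 : 0 ≤ Real.exp (-(W ^ 2 / (2 * d * τ))) / √2 := by positivity
  gcongr
  refine le_trans ?_ h2
  gcongr

theorem LinSol.le_const {d : ℝ} (hd : 0 < d) {q D : ℝ → ℝ → ℝ} (h : LinSol d q D)
    (hq : ∀ t x, 0 ≤ q t x) (h0 : ∀ x, 0 ≤ D 0 x) {c : ℝ} (hc : ∀ x, D 0 x ≤ c) :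
    ∀ t ≥ 0, ∀ x, D t x ≤ c := by
  intro t ht x
  obtain ⟨B, hB⟩ := h.bdd
  have h1 := h.le_heat hd hq h0 t ht x
  have h2 := heat_abs_le hd (S := fun _ => D 0) (s := 0) (B := c)
    (fun x => by rw [abs_of_nonneg (h0 x)]; exact hc x) t x
  exact h1.trans ((le_abs_self _).trans h2)

theorem LinSol.osc {d : ℝ} (hd : 0 < d) {q Y : ℝ → ℝ → ℝ} {Q : ℝ} (h : LinSol d q Y)
    (hq : ∀ t x, 0 ≤ q t x) (hQ : ∀ t x, q t x ≤ Q) (h0 : ∀ x, 0 ≤ Y 0 x) {ω L : ℝ} (hω : 0 < ω)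
    (hL : 0 < L) (hper : ∀ t ≥ 0, ∀ x, Y t (x + L) = Y t x) (x : ℝ) :
    hc d Q (ω / 2) L * Y ω x ≤ Y (ω / 2) x := by
  have hnn := h.nonneg hd hq h0
  have hsh := h.tshift (a := ω / 2 / 2) (by positivity)
  have hle := hsh.le_const hd (fun t x => hq _ x) (fun x => hnn _ (by positivity) x)
    (c := Y (ω / 2) x / hc d Q (ω / 2) L) (fun y => by
      rw [le_div_iff₀ (hc_pos _ _ _ _), mul_comm, add_zero]
      -- y ≡ x + w
      have hP : Function.Periodic (Y (ω / 2 / 2)) L := fun z => hper _ (by positivity) z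
      obtain ⟨w, hw, hwe⟩ := hP.exists_mem_Ico hL y x
      rw [hwe]
      have := h.harnack hd hq hQ h0 (half_pos hω) (W := L) (w := w - x)
        (by rw [abs_le]; constructor <;> linarith [hw.1, hw.2]) x
      rwa [add_sub_cancel] at this) (3 * ω / 4) (by positivity) x
  rw [le_div_iff₀ (hc_pos _ _ _ _)] at hle
  have e : ω / 2 / 2 + 3 * ω / 4 = ω := by ring
  rw [e] at hle
  linarith

theorem lin_step {d : ℝ} (hd : 0 < d) {q Y D : ℝ → ℝ → ℝ} {Q : ℝ} (hY : LinSol d q Y) (hD : LinSol d q D)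
    (hq : ∀ t x, 0 ≤ q t x) (hQ : ∀ t x, q t x ≤ Q) (h0 : ∀ x, 0 ≤ Y 0 x) {ω L W : ℝ} (hω : 0 < ω)
    (hL : 0 < L) (hW : 0 < W) (hper : ∀ t ≥ 0, ∀ x, Y t (x + L) = Y t x)
    (hperW : ∀ t ≥ 0, ∀ x, Y t (x + W) = Y t x)
    (hanti : ∀ t ≥ 0, ∀ x, D t (x + W) = - D t x) {M : ℝ} (hM : 0 ≤ M)
    (hDY : ∀ x, D 0 x ≤ M * Y 0 x) (x : ℝ) :
    D ω x ≤ (1 - hc d Q ω W * hc d Q (ω / 2) L) * M * Y ω x := by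
  have hφ := (hY.cmul M).sub hD
  have hφ0 : ∀ x, 0 ≤ M * Y 0 x - D 0 x := fun x => by linarith [hDY x]
  have h1 := hφ.harnack hd hq hQ hφ0 hω (W := W) (w := 0) (by rw [abs_zero]; exact hW.le) x
  have h2 := hφ.harnack hd hq hQ hφ0 hω (W := W) (w := W) (by rw [abs_of_pos hW]) x
  simp only [add_zero] at h1
  rw [hperW _ (half_pos hω).le, hanti _ (half_pos hω).le] at h2
  have h3 := hY.osc hd hq hQ h0 hω hL hper x
  have h4 := hc_pos d Q ω W
  have h5 : hc d Q ω W * (hc d Q (ω / 2) L * Y ω x) ≤ hc d Q ω W * Y (ω / 2) x := by gcongr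
  have h6 : M * (hc d Q ω W * (hc d Q (ω / 2) L * Y ω x)) ≤ M * (hc d Q ω W * Y (ω / 2) x) := by gcongr
  nlinarith

theorem lin_main {d Q ω L W : ℝ} (hd : 0 < d) (hω : 0 < ω) (hL : 0 < L) (hW : 0 < W) {k : ℕ}
    (hk : W = k * L) : ∃ δ, 0 < δ ∧ ∀ (q : ℝ → ℝ → ℝ) (C : ℝ),
      Continuous (fun r : ℝ × ℝ => q r.1 r.2) → (∀ t x, 0 ≤ q t x) → (∀ t x, q t x ≤ Q) →
      (∀ t x y, |q t x - q t y| ≤ C * |x - y|) → (∀ t x, q t (x + L) = q t x) →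
      ∃ Y D, LinSol d q Y ∧ LinSol d q D ∧ (∀ x, Y 0 x = 1) ∧
        (∀ x, D 0 x = Real.cos (Real.pi / W * x)) ∧ (∀ t ≥ 0, ∀ x, 0 < Y t x) ∧
        (∀ t ≥ 0, ∀ x, |D t x| ≤ Y t x) ∧
        ∀ m : ℕ, ∀ x, |D (m * ω) x| ≤ (1 - δ) ^ m * Y (m * ω) x := by
  refine ⟨hc d Q ω W * hc d Q (ω / 2) L, mul_pos (hc_pos _ _ _ _) (hc_pos _ _ _ _), ?_⟩
  intro q C hqc hq hQ hC hqL
  obtain ⟨Y, hY, hY0, -⟩ := lin_exists hd hqc hq hQ hC 0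
  obtain ⟨D, hD, hD0, -⟩ := lin_exists hd hqc hq hQ hC (Real.pi / W)
  simp only [zero_mul, Real.cos_zero] at hY0
  have hqW : ∀ t x, q t (x + W) = q t x := fun t x => by
    rw [hk]
    have : Function.Periodic (q t) L := fun x => hqL t x
    exact this.nat_mul k x
  have hYpos : ∀ t ≥ 0, ∀ x, 0 < Y t x := by
    intro t ht x
    have h1 := hY.ge_heat hd hq hQ (fun x => by rw [hY0]; norm_num) t ht x
    have e : KS (gk d) (fun _ => Y 0) t 0 x = 1 := by
      have : (fun _ : ℝ => Y 0) = fun _ _ => (1:ℝ) := by ext a b; exact hY0 b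
      rw [this, KS_const, gk_integral hd, one_mul]
    rw [e, mul_one] at h1
    exact (Real.exp_pos _).trans_le h1
  have hYper : ∀ P, (∀ t x, q t (x + P) = q t x) → ∀ t ≥ 0, ∀ x, Y t (x + P) = Y t x := by
    intro P hP t ht x
    have h1 := hY.shift (le_refl 0) P
    have e : (fun t x => q (0 + t) (P + x)) = q := by
      ext t x; rw [zero_add, add_comm]; exact hP t x
    rw [e] at h1
    have := h1.uniq hd hY hq (fun x => by simp [hY0]) t ht x
    rw [zero_add, add_comm] at this; exact this
  have hDanti : ∀ t ≥ 0, ∀ x, D t (x + W) = - D t x := by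
    intro t ht x
    have h1 := hD.shift (le_refl 0) W
    have e : (fun t x => q (0 + t) (W + x)) = q := by
      ext t x; rw [zero_add, add_comm]; exact hqW t x
    rw [e] at h1
    have := h1.uniq hd (hD.cmul (-1)) hq (fun x => by
      simp only [zero_add, hD0]
      rw [mul_add, div_mul_cancel₀ _ hW.ne', add_comm, Real.cos_add_pi]; ring) t ht x
    rw [zero_add, add_comm] at this; rw [this]; ring
  have hDY : ∀ t ≥ 0, ∀ x, |D t x| ≤ Y t x := by
    intro t ht x
    rw [abs_le]
    constructor
    · have := (hY.cmul (-1)).mono hd hD hq (fun x => by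
        rw [hY0, hD0]; linarith [Real.neg_one_le_cos (Real.pi / W * x)]) t ht x
      linarith
    · exact hD.mono hd hY hq (fun x => by rw [hY0, hD0]; exact Real.cos_le_one _) t ht x
  refine ⟨Y, D, hY, hD, hY0, hD0, hYpos, hDY, ?_⟩
  -- δ ≤ 1
  set δ := hc d Q ω W * hc d Q (ω / 2) L with hδ
  have hQ0 : 0 ≤ Q := (hq 0 0).trans (hQ 0 0)
  have hhc : ∀ τ W', 0 < τ → hc d Q τ W' ≤ 1 := by
    intro τ W' hτ
    unfold hc
    have h1 : Real.exp (-(Q * τ)) ≤ 1 := Real.exp_le_one_iff.2 (by have := mul_nonneg hQ0 hτ.le; linarith)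
    have h2 : Real.exp (-(W' ^ 2 / (2 * d * τ))) ≤ 1 := Real.exp_le_one_iff.2 (by
      have : 0 ≤ W' ^ 2 / (2 * d * τ) := by positivity
      linarith)
    have h3 : 1 ≤ √2 := Real.one_le_sqrt.2 (by norm_num)
    have h4 : Real.exp (-(W' ^ 2 / (2 * d * τ))) / √2 ≤ 1 := by
      rw [div_le_one (by positivity)]; linarith
    exact mul_le_one₀ h1 (by positivity) h4
  have hδ1 : δ ≤ 1 := mul_le_one₀ (hhc _ _ hω) (hc_pos _ _ _ _).le (hhc _ _ (half_pos hω))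
  intro m
  induction m with
  | zero => intro x; simpa using hDY 0 le_rfl x
  | succ m ih =>
    intro x
    have hs : 0 ≤ (m:ℝ) * ω := by positivity
    have hMn : 0 ≤ (1 - δ) ^ m := pow_nonneg (by linarith) _
    have e : ((m + 1 : ℕ) : ℝ) * ω = m * ω + ω := by push_cast; ring
    rw [e, pow_succ, mul_comm ((1 - δ) ^ m)]
    have hYs := hY.tshift hs
    have hDs := hD.tshift hs
    have hper1 := hYper L hqL
    have hper2 := hYper W hqW
    rw [abs_le]
    constructor
    · have := lin_step hd hYs (hDs.cmul (-1)) (fun t x => hq _ x) (fun t x => hQ _ x)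
        (fun x => (hYpos _ (by linarith) x).le) hω hL hW (fun t ht x => hper1 _ (by linarith) x)
        (fun t ht x => hper2 _ (by linarith) x)
        (fun t ht x => by rw [hDanti _ (by linarith) x]; ring) hMn
        (fun x => by rw [add_zero]; linarith [(abs_le.1 (ih x)).1]) x
      linarith
    · exact lin_step hd hYs hDs (fun t x => hq _ x) (fun t x => hQ _ x)
        (fun x => (hYpos _ (by linarith) x).le) hω hL hW (fun t ht x => hper1 _ (by linarith) x)
        (fun t ht x => hper2 _ (by linarith) x)
        (fun t ht x => hDanti _ (by linarith) x) hMn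
        (fun x => by rw [add_zero]; exact (abs_le.1 (ih x)).2) x


theorem per_red {β : Type*} {ω L : ℝ} (hω : 0 < ω) (hL : 0 < L) (G : ℝ → ℝ → β)
    (ht : ∀ t x, G (t + ω) x = G t x) (hx : ∀ t x, G t (x + L) = G t x) (t x : ℝ) :
    ∃ t' ∈ Icc 0 ω, ∃ x' ∈ Icc 0 L, G t x = G t' x' := by
  have h1 : Function.Periodic G ω := fun t => funext fun x => ht t x
  obtain ⟨t', ht', e1⟩ := h1.exists_mem_Ico₀ hω t
  have h2 : Function.Periodic (G t') L := fun x => hx t' x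
  obtain ⟨x', hx', e2⟩ := h2.exists_mem_Ico₀ hL x
  exact ⟨t', ⟨ht'.1, ht'.2.le⟩, x', ⟨hx'.1, hx'.2.le⟩, by rw [e1, e2]⟩

theorem per_bdd {ω L : ℝ} (hω : 0 < ω) (hL : 0 < L) (G : ℝ → ℝ → ℝ)
    (hc : Continuous fun r : ℝ × ℝ => G r.1 r.2)
    (ht : ∀ t x, G (t + ω) x = G t x) (hx : ∀ t x, G t (x + L) = G t x) :
    ∃ B, 0 ≤ B ∧ ∀ t x, |G t x| ≤ B := by
  obtain ⟨B, hB⟩ := (isCompact_Icc.prod isCompact_Icc : IsCompact (Icc 0 ω ×ˢ Icc 0 L)).exists_bound_of_continuousOn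
    hc.continuousOn
  refine ⟨|B|, abs_nonneg _, fun t x => ?_⟩
  obtain ⟨t', h1, x', h2, e⟩ := per_red hω hL G ht hx t x
  rw [e]
  exact (hB (t', x') ⟨h1, h2⟩).trans (le_abs_self _)

theorem per_pos {ω L : ℝ} (hω : 0 < ω) (hL : 0 < L) (G : ℝ → ℝ → ℝ)
    (hc : Continuous fun r : ℝ × ℝ => G r.1 r.2)
    (ht : ∀ t x, G (t + ω) x = G t x) (hx : ∀ t x, G t (x + L) = G t x) (hpos : ∀ t x, 0 < G t x) :
    ∃ b, 0 < b ∧ ∀ t x, b ≤ G t x := by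
  obtain ⟨q, hq, hm⟩ := (isCompact_Icc.prod isCompact_Icc : IsCompact (Icc 0 ω ×ˢ Icc 0 L)).exists_isMinOn
    ⟨(0, 0), ⟨⟨le_rfl, hω.le⟩, ⟨le_rfl, hL.le⟩⟩⟩ hc.continuousOn
  refine ⟨G q.1 q.2, hpos _ _, fun t x => ?_⟩
  obtain ⟨t', h1, x', h2, e⟩ := per_red hω hL G ht hx t x
  rw [e]
  exact hm (show (t', x') ∈ _ from ⟨h1, h2⟩)

section
variable {ω L : ℝ} {f : ℝ → ℝ → ℝ → ℝ}

theorem f_ext_cont (hf : BasicAssumptions ω L f) :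
    Continuous fun q : ℝ × ℝ × ℝ => f q.1 q.2.1 (max q.2.2 0) :=
  hf.cont.comp_continuous (f := fun q : ℝ × ℝ × ℝ => (q.1, q.2.1, max q.2.2 0)) (by fun_prop)
    (fun q => by show (0:ℝ) ≤ max q.2.2 0; exact le_max_right _ _)

theorem f_bdd (hω : 0 < ω) (hL : 0 < L) (hf : BasicAssumptions ω L f) (K : ℝ) :
    ∃ B, 0 ≤ B ∧ ∀ t x, ∀ u ∈ Icc 0 K, |f t x u| ≤ B := by
  obtain ⟨B, hB⟩ := (isCompact_Icc.prod (isCompact_Icc.prod isCompact_Icc) :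
    IsCompact (Icc 0 ω ×ˢ (Icc 0 L ×ˢ Icc 0 K))).exists_bound_of_continuousOn (f_ext_cont hf).continuousOn
  refine ⟨|B|, abs_nonneg _, fun t x u hu => ?_⟩
  obtain ⟨t', h1, x', h2, e⟩ := per_red hω hL (fun t x u => f t x (max u 0))
    (fun t x => funext fun u => hf.per_t t x _ (le_max_right _ _))
    (fun t x => funext fun u => hf.per_x t x _ (le_max_right _ _)) t x
  have e1 := congrFun e u
  simp only [max_eq_left hu.1] at e1
  rw [e1]
  have := hB (t', x', u) ⟨h1, h2, hu⟩
  simp only [max_eq_left hu.1] at this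
  exact this.trans (le_abs_self _)

theorem fu_bdd (hω : 0 < ω) (hL : 0 < L) (hf : BasicAssumptions ω L f)
    {fu : ℝ → ℝ → ℝ → ℝ}
    (h1 : ∀ t x u : ℝ, 0 ≤ u → HasDerivWithinAt (fun w => f t x w) (fu t x u) (Set.Ici 0) u)
    (h2 : ∀ ε > 0, ∃ δ > 0, ∀ t x u v : ℝ, 0 ≤ u → 0 ≤ v → |u - v| ≤ δ →
      |fu t x u - fu t x v| ≤ ε) (K : ℝ) :
    ∃ Λ, 0 ≤ Λ ∧ ∀ t x, ∀ u ∈ Icc 0 K, |fu t x u| ≤ Λ := by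
  obtain ⟨δ, hδ, hδ'⟩ := h2 1 one_pos
  obtain ⟨B, hB0, hB⟩ := f_bdd hω hL hf (K + δ)
  refine ⟨2 * B / δ + 1, by positivity, fun t x u hu => ?_⟩
  obtain ⟨c, hc, hce⟩ := exists_hasDerivAt_eq_slope (fun w => f t x w) (fu t x) (show u < u + δ by linarith)
    (fun w hw => ((h1 t x w (hu.1.trans hw.1)).continuousWithinAt).mono (fun y hy => hu.1.trans hy.1))
    (fun w hw => (h1 t x w (hu.1.trans hw.1.le)).hasDerivAt (Ici_mem_nhds (hu.1.trans_lt hw.1)))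
  have h3 := hδ' t x u c hu.1 (hu.1.trans hc.1.le) (by rw [abs_le]; constructor <;> linarith [hc.1, hc.2])
  have h4 := hB t x u ⟨hu.1, by linarith [hu.2]⟩
  have h5 := hB t x (u + δ) ⟨by linarith [hu.1], by linarith [hu.2]⟩
  have h6 : |fu t x c| ≤ 2 * B / δ := by
    rw [hce, add_sub_cancel_left, abs_div, abs_of_pos hδ]
    gcongr
    have := abs_sub (f t x (u + δ)) (f t x u)
    linarith
  have h7 : |fu t x u| ≤ |fu t x u - fu t x c| + |fu t x c| := by
    have := abs_add_le (fu t x u - fu t x c) (fu t x c); rwa [sub_add_cancel] at this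
  linarith

theorem f_lip (hω : 0 < ω) (hL : 0 < L) (hf : BasicAssumptions ω L f) (K : ℝ) :
    ∃ Λ, 0 ≤ Λ ∧ ∀ t x, ∀ u ∈ Icc 0 K, ∀ v ∈ Icc 0 K, |f t x u - f t x v| ≤ Λ * |u - v| := by
  obtain ⟨fu, h1, h2⟩ := hf.c1
  obtain ⟨Λ, hΛ, hb⟩ := fu_bdd hω hL hf h1 h2 K
  refine ⟨Λ, hΛ, fun t x u hu v hv => ?_⟩
  exact Convex.norm_image_sub_le_of_norm_hasDerivWithin_le (f := fun w => f t x w) (f' := fu t x)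
    (s := Icc 0 K) (fun w hw => (h1 t x w hw.1).mono fun y hy => hy.1) (fun w hw => hb t x w hw)
    (convex_Icc _ _) hv hu

theorem cauchy_exists {d : ℝ} (hd : 0 < d) (hω : 0 < ω) (hL : 0 < L) (hf : BasicAssumptions ω L f)
    {K : ℝ} (hK : 0 < K) (hfK : ∀ t x, f t x K ≤ 0) :
    ∃ v, IsCauchySolution d f (fun _ => K) v ∧ Continuous (fun q : ℝ × ℝ => v q.1 q.2) ∧
      (∀ t > 0, ∀ x, POp d v t x (f t x (v t x))) ∧ ∀ t ≥ 0, ∀ x, v t x ∈ Icc 0 K := by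
  obtain ⟨B, hB0, hB⟩ := f_bdd hω hL hf K
  obtain ⟨Λ, hΛ0, hΛ⟩ := f_lip hω hL hf K
  obtain ⟨α, hα, hH⟩ := hf.holder
  obtain ⟨C, hC0, hC⟩ := hH K hK
  set cl : ℝ → ℝ := fun c => max (min c K) 0 with hcl
  have cl1 : ∀ c, cl c ∈ Icc 0 K := fun c => ⟨le_max_right _ _, max_le (min_le_right _ _) hK.le⟩
  have cll : ∀ a b, |cl a - cl b| ≤ |a - b| := fun a b => by
    have h1 := abs_max_sub_max_le_abs (min a K) (min b K) 0
    have h2 := abs_min_sub_min_le_max a K b K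
    refine h1.trans (h2.trans ?_)
    simp
  set F : ℝ → ℝ → ℝ → ℝ := fun t x w => f t x (cl (K + w)) with hF
  obtain ⟨w, hwc, hw0, hwb, hwp⟩ := exists_mild (F := F) (B := B) (Λ := Λ) (α := α) (C := C) hd
    ((f_ext_cont hf).comp (f := fun r : ℝ × ℝ × ℝ => (r.1, r.2.1, min (K + r.2.2) K)) (by fun_prop))
    (fun t x u => hB t x _ (cl1 _)) hΛ0
    (fun t x u v => (hΛ t x _ (cl1 _) _ (cl1 _)).trans (by
      have := cll (K + u) (K + v)
      rw [add_sub_add_left_eq_sub] at this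
      gcongr)) hα.1 hα.2.le hC0.le
    (fun t x y u => by
      have := hC t t x y (cl (K + u)) (cl1 _).1 (cl1 _).2
      rwa [sub_self, abs_zero, Real.zero_rpow (by linarith [hα.1]), zero_add] at this)
  set v : ℝ → ℝ → ℝ := fun t x => K + w t x with hv
  have hvc : Continuous (fun q : ℝ × ℝ => v q.1 q.2) := by fun_prop
  have hvp : ∀ t > 0, ∀ x, POp d v t x (f t x (cl (v t x))) := fun t ht x => by
    have := (POp.const (d := d) (t := t) (x := x) K).add (hwp t ht x)
    convert this using 1
    simp only [hF, hv]; ring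
  have hvb : ∀ t ≥ 0, ∀ x, v t x ∈ Icc 0 K := by
    intro t ht x
    have hb : ∀ s ∈ Icc 0 t, ∀ x, |w s x| ≤ B * t := fun s hs x =>
      (hwb s hs.1 x).trans (by have := hs.2; gcongr)
    constructor
    · have := max_principle (C := 0) (T := t) hd (fun t x => - v t x) (by fun_prop)
        ⟨B * t, fun s hs x => by
          have := abs_le.1 (hb s hs x); simp only [hv]; linarith [this.1]⟩
        (fun x => by simp only [hv, hw0]; linarith)
        (fun s hs x hz => ⟨_, (hvp s hs.1 x).neg, by
          have : cl (v s x) = 0 := by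
            simp only [hcl]; rw [max_eq_right]; exact (min_le_left _ _).trans (by linarith)
          rw [this, hf.zero]; simp⟩) t ⟨ht, le_rfl⟩ x
      linarith
    · have := max_principle (C := 0) (T := t) hd (fun t x => v t x - K) (by fun_prop)
        ⟨B * t, fun s hs x => by
          have := abs_le.1 (hb s hs x); simp only [hv]; linarith [this.2]⟩
        (fun x => by simp only [hv, hw0]; linarith)
        (fun s hs x hz => ⟨_, (hvp s hs.1 x).sub (POp.const K), by
          have : cl (v s x) = K := by
            simp only [hcl]; rw [min_eq_right (by linarith), max_eq_left hK.le]
          rw [this]; linarith [hfK s x]⟩) t ⟨ht, le_rfl⟩ x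
      linarith
  have hvp' : ∀ t > 0, ∀ x, POp d v t x (f t x (v t x)) := fun t ht x => by
    have := hvp t ht x
    have e : cl (v t x) = v t x := by
      have := hvb t ht.le x
      simp only [hcl]; rw [min_eq_left this.2, max_eq_left this.1]
    rwa [e] at this
  refine ⟨v, ⟨fun x => by simp [hv, hw0], hvc.continuousOn, fun q hq => (hvp' q.1 hq q.2).solves,
    ⟨K, fun t ht x => ?_⟩⟩, hvc, hvp', hvb⟩
  have := hvb t ht x
  rw [abs_of_nonneg this.1]; exact this.2
end


section
variable {d μ ω L : ℝ} {f : ℝ → ℝ → ℝ → ℝ} {p : ℝ → ℝ → ℝ}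

theorem p_cont (hd : 0 < d) (hω : 0 < ω) (hL : 0 < L) (hf : BasicAssumptions ω L f)
    (hp : HypH d ω L f p) : Continuous (fun q : ℝ × ℝ => p q.1 q.2) := by
  obtain ⟨M, hM, hM'⟩ := hf.neg_large
  obtain ⟨v, hv, hvc, -, -⟩ := cauchy_exists hd hω hL hf hM (fun t x => hM' t x M le_rfl)
  rw [continuous_iff_continuousAt]
  intro q0
  apply continuousAt_of_locally_uniform_approx_of_continuousAt
  intro U hU
  obtain ⟨ε, hε, hεU⟩ := Metric.mem_uniformity_dist.1 hU
  obtain ⟨S, hS⟩ := hp.conv (fun _ => M) continuous_const ⟨|M|, fun _ => le_rfl⟩ ⟨M, hM, fun _ => le_rfl⟩ v hv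
    (ε / 2) (by positivity)
  obtain ⟨n, hn⟩ := exists_nat_ge ((|S| + |q0.1| + 1) / ω)
  rw [div_le_iff₀ hω] at hn
  refine ⟨{q | q0.1 - 1 < q.1}, (isOpen_lt continuous_const continuous_fst).mem_nhds (by simp),
    fun q => v (q.1 + n * ω) q.2, Continuous.continuousAt (hvc.comp (f := fun q : ℝ × ℝ => (q.1 + n * ω, q.2)) (by fun_prop)), ?_⟩
  intro q hq
  apply hεU
  simp only [mem_setOf_eq] at hq
  have h1 := hS S le_rfl (q.1 + n * ω - S) (by linarith [le_abs_self S, neg_abs_le q0.1]) q.2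
  rw [sub_add_cancel] at h1
  have h2 : p (q.1 + n * ω) q.2 = p q.1 q.2 :=
    (show Function.Periodic (fun t => p t q.2) ω from fun t => hp.per_t t _).nat_mul n q.1
  rw [h2] at h1
  rw [dist_comm, Real.dist_eq]
  linarith

theorem a_cont (hf : BasicAssumptions ω L f) {fu : ℝ → ℝ → ℝ → ℝ}
    (h1 : ∀ t x u : ℝ, 0 ≤ u → HasDerivWithinAt (fun w => f t x w) (fu t x u) (Set.Ici 0) u)
    (h2 : ∀ ε > 0, ∃ δ > 0, ∀ t x u v : ℝ, 0 ≤ u → 0 ≤ v → |u - v| ≤ δ →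
      |fu t x u - fu t x v| ≤ ε) (hp : Continuous (fun q : ℝ × ℝ => p q.1 q.2))
    (hpos : ∀ t x, 0 ≤ p t x) : Continuous (fun q : ℝ × ℝ => fu q.1 q.2 (p q.1 q.2)) := by
  apply continuous_of_uniform_approx_of_continuous
  intro U hU
  obtain ⟨ε, hε, hεU⟩ := Metric.mem_uniformity_dist.1 hU
  obtain ⟨δ, hδ, hδ'⟩ := h2 (ε / 2) (by positivity)
  refine ⟨fun q => (f q.1 q.2 (p q.1 q.2 + δ) - f q.1 q.2 (p q.1 q.2)) / δ, ?_, ?_⟩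
  · refine Continuous.div_const (Continuous.sub ?_ ?_) _
    · exact hf.cont.comp_continuous (f := fun q : ℝ × ℝ => (q.1, q.2, p q.1 q.2 + δ)) (by fun_prop)
        (fun q => by show 0 ≤ p q.1 q.2 + δ; linarith [hpos q.1 q.2])
    · exact hf.cont.comp_continuous (f := fun q : ℝ × ℝ => (q.1, q.2, p q.1 q.2)) (by fun_prop)
        (fun q => hpos q.1 q.2)
  · intro q
    apply hεU
    have hu := hpos q.1 q.2
    set u := p q.1 q.2
    obtain ⟨c, hc, hce⟩ := exists_hasDerivAt_eq_slope (fun w => f q.1 q.2 w) (fu q.1 q.2)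
      (show u < u + δ by linarith)
      (fun w hw => ((h1 q.1 q.2 w (hu.trans hw.1)).continuousWithinAt).mono (fun y hy => hu.trans hy.1))
      (fun w hw => (h1 q.1 q.2 w (hu.trans hw.1.le)).hasDerivAt (Ici_mem_nhds (hu.trans_lt hw.1)))
    have h3 := hδ' q.1 q.2 u c hu (hu.trans hc.1.le) (by rw [abs_le]; constructor <;> linarith [hc.1, hc.2])
    rw [hce, add_sub_cancel_left] at h3
    rw [Real.dist_eq]
    linarith

theorem tangent1 {φ : ℝ → ℝ} {a P l r : ℝ} (hl : l < P) (hr : P < r)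
    (h2 : ContDiffOn ℝ 2 φ (Icc l r)) (ha : HasDerivAt φ a P)
    (hdd : ∀ w ∈ Icc l r, derivWithin (derivWithin φ (Icc l r)) (Icc l r) w ≤ 0) :
    ∀ y ∈ Icc l r, φ y - φ P ≤ a * (y - P) := by
  have hU : UniqueDiffOn ℝ (Icc l r) := uniqueDiffOn_Icc (hl.trans hr)
  have hd1 : ∀ x ∈ Ioo l r, deriv φ =ᶠ[𝓝 x] derivWithin φ (Icc l r) := by
    intro x hx
    filter_upwards [Ioo_mem_nhds hx.1 hx.2] with y hy
    rw [derivWithin_of_mem_nhds (Icc_mem_nhds hy.1 hy.2)]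
  have hdw : DifferentiableOn ℝ (derivWithin φ (Icc l r)) (Icc l r) :=
    (h2.derivWithin hU (m := 1) (by norm_num)).differentiableOn (by norm_num)
  have hconc : ConcaveOn ℝ (Icc l r) φ := by
    apply concaveOn_of_deriv2_nonpos (convex_Icc _ _) h2.continuousOn
    · exact (h2.differentiableOn (by norm_num)).mono interior_subset
    · rw [interior_Icc]
      intro x hx
      have := (hdw x (Ioo_subset_Icc_self hx)).differentiableAt (Icc_mem_nhds hx.1 hx.2)
      exact (this.congr_of_eventuallyEq (hd1 x hx)).differentiableWithinAt
    · rw [interior_Icc]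
      intro x hx
      have e : deriv^[2] φ x = derivWithin (derivWithin φ (Icc l r)) (Icc l r) x := by
        show deriv (deriv φ) x = _
        rw [(hd1 x hx).deriv_eq, derivWithin_of_mem_nhds (Icc_mem_nhds hx.1 hx.2)]
      rw [e]; exact hdd x (Ioo_subset_Icc_self hx)
  intro y hy
  have hPm : P ∈ Icc l r := ⟨hl.le, hr.le⟩
  rcases lt_trichotomy y P with h | h | h
  · have := hconc.le_slope_of_hasDerivAt hy hPm h ha
    rw [slope_def_field, le_div_iff₀ (by linarith)] at this
    linarith
  · subst h; simp
  · have := hconc.slope_le_of_hasDerivAt hPm hy h ha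
    rw [slope_def_field, div_le_iff₀ (by linarith)] at this
    linarith

theorem antitone_tangent {φ : ℝ → ℝ} {a P l r : ℝ} (hP : 0 < P) (hl : l < P) (hr : P < r)
    (ha : HasDerivAt φ a P) (hA : AntitoneOn (fun w => φ w / w) (Icc l r)) : a * P ≤ φ P := by
  have h1 : HasDerivAt (fun w => φ w / w) ((a * P - φ P * 1) / P ^ 2) P :=
    ha.div (hasDerivAt_id P) hP.ne'
  have h2 : derivWithin (fun w => φ w / w) (Icc l r) P ≤ 0 := hA.derivWithin_nonpos
  rw [derivWithin_of_mem_nhds (Icc_mem_nhds hl hr), h1.deriv, div_nonpos_iff] at h2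
  have : 0 < P ^ 2 := by positivity
  rcases h2 with h | h <;> linarith [h.1, h.2]

section
variable {g₀ h₀ : ℝ} {u₀ : ℝ → ℝ} {u : ℝ → ℝ → ℝ} {g h : ℝ → ℝ}

theorem fbp_in (hgh : g₀ < h₀) (hu₀ : memH g₀ h₀ u₀) (hu : IsFBPSolution d μ f g₀ h₀ u₀ u g h)
    {t x : ℝ} (ht : 0 ≤ t) (hx : u t x ≠ 0) : g t < x ∧ x < h t := by
  by_contra hcon
  apply hx
  by_cases h1 : x < g t ∨ h t < x
  · exact hu.ext t ht x h1
  push Not at h1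
  have h2 : x = g t ∨ x = h t := by
    by_contra h3
    push Not at h3
    exact hcon ⟨lt_of_le_of_ne h1.1 (Ne.symm h3.1), lt_of_le_of_ne h1.2 h3.2⟩
  rcases ht.eq_or_lt with rfl | ht
  · rw [hu.g_init, hu.h_init] at h2
    rcases h2 with rfl | rfl
    · rw [hu.init _ ⟨le_rfl, hgh.le⟩]; exact hu₀.2.1
    · rw [hu.init _ ⟨hgh.le, le_rfl⟩]; exact hu₀.2.2.1
  · rcases h2 with rfl | rfl
    · exact hu.bc_left t ht
    · exact hu.bc_right t ht

theorem fbp_cont (hgh : g₀ < h₀) (hu₀ : memH g₀ h₀ u₀) (hu : IsFBPSolution d μ f g₀ h₀ u₀ u g h) :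
    ContinuousOn (fun q : ℝ × ℝ => u q.1 q.2) {q : ℝ × ℝ | 0 ≤ q.1} := by
  set S : Set (ℝ × ℝ) := {q : ℝ × ℝ | 0 ≤ q.1} with hS
  set A : Set (ℝ × ℝ) := {q : ℝ × ℝ | 0 ≤ q.1 ∧ g q.1 ≤ q.2 ∧ q.2 ≤ h q.1} with hA
  have hg : ContinuousOn (fun q : ℝ × ℝ => g q.1) S :=
    hu.g_smooth.continuousOn.comp continuous_fst.continuousOn (fun q hq => hq)
  have hh : ContinuousOn (fun q : ℝ × ℝ => h q.1) S :=
    hu.h_smooth.continuousOn.comp continuous_fst.continuousOn (fun q hq => hq)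
  have hx : ContinuousOn (fun q : ℝ × ℝ => q.2) S := continuous_snd.continuousOn
  have z0 : ∀ q ∈ S \ A, u q.1 q.2 = 0 := by
    intro q hq
    apply hu.ext q.1 hq.1
    by_contra h3
    push Not at h3
    exact hq.2 ⟨hq.1, h3⟩
  intro q hq
  by_cases h1 : g q.1 < q.2 ∧ q.2 < h q.1
  · have h2 : A ∈ 𝓝[S] q := by
      filter_upwards [(hg q hq).eventually_lt (hx q hq) h1.1, (hx q hq).eventually_lt (hh q hq) h1.2,
        self_mem_nhdsWithin] with r a b c
      exact ⟨c, a.le, b.le⟩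
    exact (hu.u_cont q ⟨hq, h1.1.le, h1.2.le⟩).mono_of_mem_nhdsWithin h2
  · have hz : u q.1 q.2 = 0 := by
      by_contra hz
      exact h1 (fbp_in hgh hu₀ hu hq hz)
    by_cases hqA : q ∈ A
    · have e : S = A ∪ (S \ A) := by
        ext r; constructor
        · intro hr; by_cases hrA : r ∈ A
          · exact Or.inl hrA
          · exact Or.inr ⟨hr, hrA⟩
        · rintro (hr | hr)
          · exact hr.1
          · exact hr.1
      rw [e]
      refine (hu.u_cont q hqA).union ?_
      refine (continuousWithinAt_const (b := (0:ℝ))).congr (fun r hr => z0 r hr) hz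
    · have h2 : S \ A ∈ 𝓝[S] q := by
        have : q.2 < g q.1 ∨ h q.1 < q.2 := by
          by_contra h3
          push Not at h3
          exact hqA ⟨hq, h3⟩
        rcases this with h3 | h3
        · filter_upwards [(hx q hq).eventually_lt (hg q hq) h3, self_mem_nhdsWithin] with r a c
          exact ⟨c, fun h => by linarith [h.2.1]⟩
        · filter_upwards [(hh q hq).eventually_lt (hx q hq) h3, self_mem_nhdsWithin] with r a c
          exact ⟨c, fun h => by linarith [h.2.2]⟩
      refine ContinuousWithinAt.mono_of_mem_nhdsWithin (t := S \ A) ?_ h2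
      exact (continuousWithinAt_const (b := (0:ℝ))).congr (fun r hr => z0 r hr) hz

theorem fbp_supp (hu : IsFBPSolution d μ f g₀ h₀ u₀ u g h) (T : ℝ) :
    ∃ R, 0 < R ∧ ∀ t ∈ Icc 0 T, ∀ x, R < |x| → u t x = 0 := by
  obtain ⟨B1, hB1⟩ := (isCompact_Icc (a := (0:ℝ)) (b := T)).exists_bound_of_continuousOn
    (hu.g_smooth.continuousOn.mono fun x hx => hx.1)
  obtain ⟨B2, hB2⟩ := (isCompact_Icc (a := (0:ℝ)) (b := T)).exists_bound_of_continuousOn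
    (hu.h_smooth.continuousOn.mono fun x hx => hx.1)
  refine ⟨|B1| + |B2| + 1, by positivity, fun t ht x hx => ?_⟩
  apply hu.ext t ht.1
  have h1 := abs_le.1 (hB1 t ht)
  have h2 := abs_le.1 (hB2 t ht)
  rcases le_or_gt 0 x with h0 | h0
  · rw [abs_of_nonneg h0] at hx
    right; linarith [h2.2, le_abs_self B2, abs_nonneg B1]
  · rw [abs_of_neg h0] at hx
    left; linarith [h1.1, le_abs_self B1, abs_nonneg B2]

theorem fbp_bdd (hgh : g₀ < h₀) (hu₀ : memH g₀ h₀ u₀) (hu : IsFBPSolution d μ f g₀ h₀ u₀ u g h) (T : ℝ) :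
    ∃ B, ∀ t ∈ Icc 0 T, ∀ x, |u t x| ≤ B := by
  obtain ⟨R, hR, hs⟩ := fbp_supp hu T
  obtain ⟨B, hB⟩ := (isCompact_Icc.prod isCompact_Icc : IsCompact (Icc 0 T ×ˢ Icc (-R) R)).exists_bound_of_continuousOn
    ((fbp_cont hgh hu₀ hu).mono fun q hq => hq.1.1)
  refine ⟨|B|, fun t ht x => ?_⟩
  by_cases hx : |x| ≤ R
  · exact (hB (t, x) ⟨ht, abs_le.1 hx⟩).trans (le_abs_self _)
  · rw [hs t ht x (not_le.1 hx), abs_zero]; exact abs_nonneg _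

theorem fbp_POp (hgh : g₀ < h₀) (hu₀ : memH g₀ h₀ u₀) (hu : IsFBPSolution d μ f g₀ h₀ u₀ u g h)
    {t x : ℝ} (ht : 0 < t) (hx : u t x ≠ 0) : POp d u t x (f t x (u t x)) := by
  have h1 := fbp_in hgh hu₀ hu ht.le hx
  refine POp.of_solves hu.pde ?_
  filter_upwards [Ioo_mem_nhds h1.1 h1.2] with y hy
  exact ⟨ht, hy.1, hy.2⟩

theorem fbp_upper (hd : 0 < d) (hω : 0 < ω) (hL : 0 < L) (hf : BasicAssumptions ω L f)
    (hp : HypH d ω L f p) (hgh : g₀ < h₀) (hu₀ : memH g₀ h₀ u₀)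
    (hu : IsFBPSolution d μ f g₀ h₀ u₀ u g h) :
    ∃ K, (∀ t ≥ 0, ∀ x, u t x ≤ K) ∧
      ∀ ε > 0, ∃ S, ∀ t ≥ S, 0 ≤ t → ∀ x, u t x ≤ p t x + ε := by
  obtain ⟨M, hM, hM'⟩ := hf.neg_large
  obtain ⟨B, hB⟩ := fbp_bdd hgh hu₀ hu 0
  set K := max M B with hK
  have hK0 : 0 < K := hM.trans_le (le_max_left _ _)
  obtain ⟨v, hv, hvc, hvp, hvb⟩ := cauchy_exists hd hω hL hf hK0 (fun t x => hM' t x K (le_max_left _ _))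
  obtain ⟨Λ, hΛ0, hΛ⟩ := f_lip hω hL hf K
  have hc : ∀ T, ContinuousOn (fun q : ℝ × ℝ => u q.1 q.2) (Icc 0 T ×ˢ univ) := fun T =>
    (fbp_cont hgh hu₀ hu).mono fun q hq => hq.1.1
  have huK : ∀ t ≥ 0, ∀ x, u t x ≤ K := by
    intro T hT x
    obtain ⟨B', hB'⟩ := fbp_bdd hgh hu₀ hu T
    have := max_principle (C := 0) (T := T) hd (fun t x => u t x - K)
      ((hc T).sub continuousOn_const)
      ⟨B', fun s hs x => by linarith [(abs_le.1 (hB' s hs x)).2]⟩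
      (fun x => by
        have := (abs_le.1 (hB 0 ⟨le_rfl, le_rfl⟩ x)).2
        linarith [le_max_right M B])
      (fun s hs x hz => ⟨_, (fbp_POp hgh hu₀ hu hs.1 (by intro h; rw [h] at hz; linarith)).sub (POp.const K), by
        have := hM' s x (u s x) (by linarith [le_max_left M B])
        linarith⟩) T ⟨hT, le_rfl⟩ x
    linarith
  have huv : ∀ t ≥ 0, ∀ x, u t x ≤ v t x := by
    intro T hT x
    have := max_principle (C := Λ) (T := T) hd (fun t x => u t x - v t x)
      ((hc T).sub hvc.continuousOn)
      ⟨K, fun s hs x => by linarith [huK s hs.1 x, (hvb s hs.1 x).1]⟩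
      (fun x => by rw [hv.init]; linarith [huK 0 le_rfl x])
      (fun s hs x hz => by
        have h1 := hvb s hs.1.le x
        have h2 : 0 < u s x := by linarith [h1.1]
        refine ⟨_, (fbp_POp hgh hu₀ hu hs.1 h2.ne').sub (hvp s hs.1 x), ?_⟩
        have := hΛ s x (u s x) ⟨h2.le, huK s hs.1.le x⟩ (v s x) h1
        rw [abs_of_pos hz] at this
        exact (le_abs_self _).trans this) T ⟨hT, le_rfl⟩ x
    linarith
  refine ⟨K, huK, fun ε hε => ?_⟩
  obtain ⟨S, hS⟩ := hp.conv (fun _ => K) continuous_const ⟨|K|, fun _ => le_rfl⟩ ⟨K, hK0, fun _ => le_rfl⟩ v hv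
    ε hε
  refine ⟨S, fun t ht ht0 x => ?_⟩
  have h1 := (abs_le.1 (hS t ht 0 le_rfl x)).2
  rw [zero_add] at h1
  linarith [huv t ht0 x]

end

theorem mollify (hd : 0 < d) (hω : 0 < ω) (hL : 0 < L) {a : ℝ → ℝ → ℝ}
    (hc : Continuous (fun q : ℝ × ℝ => a q.1 q.2)) (ht : ∀ t x, a (t + ω) x = a t x)
    (hx : ∀ t x, a t (x + L) = a t x) {η : ℝ} (hη : 0 < η) :
    ∃ b : ℝ → ℝ → ℝ, ∃ C, Continuous (fun q : ℝ × ℝ => b q.1 q.2) ∧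
      (∀ t x, a t x ≤ b t x) ∧ (∀ t x, b t x ≤ a t x + η) ∧
      (∀ t x y, |b t x - b t y| ≤ C * |x - y|) ∧ ∀ t x, b t (x + L) = b t x := by
  obtain ⟨B, hB0, hB⟩ := per_bdd hω hL a hc ht hx
  have hK := KS_continuous (gk_nice hd) hc hB
  have kt : ∀ τ t x, KS (gk d) a τ (t + ω) x = KS (gk d) a τ t x := fun τ t x => by
    unfold KS; simp only [ht]
  have kx : ∀ τ t x, KS (gk d) a τ t (x + L) = KS (gk d) a τ t x := fun τ t x => by
    unfold KS; congr 1; ext z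
    rw [show x + L + √τ * z = x + √τ * z + L by ring, hx]
  obtain ⟨τ, hτ, hττ⟩ : ∃ τ > 0, ∀ t x, |KS (gk d) a τ t x - a t x| ≤ η / 2 := by
    have hcpt : IsCompact (Icc 0 ω ×ˢ Icc 0 L) := isCompact_Icc.prod isCompact_Icc
    have h1 : ∀ᶠ τ in 𝓝 (0:ℝ), ∀ q ∈ Icc 0 ω ×ˢ Icc 0 L,
        |KS (gk d) a τ q.1 q.2 - a q.1 q.2| < η / 2 := by
      apply hcpt.eventually_forall_of_forall_eventually
      intro q _
      have hcc : Continuous (fun r : ℝ × (ℝ × ℝ) => |KS (gk d) a r.1 r.2.1 r.2.2 - a r.2.1 r.2.2|) := by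
        have : Continuous (fun r : ℝ × (ℝ × ℝ) => a r.2.1 r.2.2) := hc.comp continuous_snd
        exact (hK.sub this).abs
      have h2 : |KS (gk d) a 0 q.1 q.2 - a q.1 q.2| < η / 2 := by
        rw [heat_zero hd, sub_self, abs_zero]; positivity
      exact hcc.continuousAt.eventually_lt (x₀ := ((0:ℝ), q)) continuousAt_const h2
    obtain ⟨r, hr, hr'⟩ := Metric.eventually_nhds_iff.1 h1
    refine ⟨r / 2, by positivity, fun t x => ?_⟩
    have h3 := hr' (y := r / 2) (by rw [Real.dist_eq, sub_zero, abs_of_pos (by positivity)]; linarith)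
    obtain ⟨t', h1, x', h2, e⟩ := per_red hω hL (fun t x => |KS (gk d) a (r / 2) t x - a t x|)
      (fun t x => by rw [kt, ht]) (fun t x => by rw [kx, hx]) t x
    rw [e]
    exact (h3 (t', x') ⟨h1, h2⟩).le
  refine ⟨fun t x => KS (gk d) a τ t x + η / 2, (B * ∫ z, |gk1 d z|) * τ ^ (-(1/2) : ℝ), ?_, ?_, ?_, ?_, ?_⟩
  · exact (hK.comp (continuous_const.prodMk continuous_id)).add continuous_const
  · intro t x; linarith [(abs_le.1 (hττ t x)).1]
  · intro t x; linarith [(abs_le.1 (hττ t x)).2]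
  · intro t x y
    rw [add_sub_add_right_eq_sub]
    exact Convex.norm_image_sub_le_of_norm_hasDerivWithin_le (s := univ) (f := KS (gk d) a τ t)
      (fun z _ => (heat_dx hd (hc.comp (continuous_const.prodMk continuous_id)) (hB t) hτ z).hasDerivWithinAt)
      (fun z _ => k1_bound hd hB hτ t z) convex_univ (mem_univ y) (mem_univ x)
  · intro t x; simp only [kx]

end


/-- Proposition 2.2: under the extra concavity/monotonicity assumptions on `f` near `p`,
every solution of the free boundary problem drops strictly below `p(0,·)` at some time. -/
theorem solution_eventually_below_p
    (d μ ω L : ℝ) (hd : 0 < d) (hμ : 0 < μ) (hω : 0 < ω) (hL : 0 < L)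
    (f : ℝ → ℝ → ℝ → ℝ) (hf : BasicAssumptions ω L f)
    (p : ℝ → ℝ → ℝ) (hp : HypH d ω L f p)
    (hextra : ∃ ε₀ > (0:ℝ), ∀ t x : ℝ,
      ContDiffOn ℝ 2 (fun w => f t x w)
        (Set.Icc ((1 - ε₀) * p t x) ((1 + ε₀) * p t x)) ∧
      AntitoneOn (fun w => f t x w / w)
        (Set.Icc ((1 - ε₀) * p t x) ((1 + ε₀) * p t x)) ∧
      (∀ w ∈ Set.Icc ((1 - ε₀) * p t x) ((1 + ε₀) * p t x),
        derivWithin (derivWithin (fun z => f t x z)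
            (Set.Icc ((1 - ε₀) * p t x) ((1 + ε₀) * p t x)))
          (Set.Icc ((1 - ε₀) * p t x) ((1 + ε₀) * p t x)) w ≤ 0)) :
    ∀ (g₀ h₀ : ℝ), g₀ < h₀ → ∀ u₀ : ℝ → ℝ, memH g₀ h₀ u₀ →
    ∀ (u : ℝ → ℝ → ℝ) (g h : ℝ → ℝ), IsFBPSolution d μ f g₀ h₀ u₀ u g h →
    ∃ t₀ > (0:ℝ), ∀ x : ℝ, u t₀ x < p 0 x := by
  intro g₀ h₀ hgh u₀ hu₀ u g h hu
  obtain ⟨ε₀, hε₀, hex⟩ := hextra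
  obtain ⟨fu, hfu1, hfu2⟩ := hf.c1
  have hpc := p_cont hd hω hL hf hp
  obtain ⟨b, hb, hbp⟩ := per_pos hω hL p hpc hp.per_t hp.per_x hp.pos
  obtain ⟨Bp, hBp0, hBp⟩ := per_bdd hω hL p hpc hp.per_t hp.per_x
  have hder : ∀ t x, HasDerivAt (fun w => f t x w) (fu t x (p t x)) (p t x) := fun t x =>
    (hfu1 t x _ (hp.pos t x).le).hasDerivAt (Ici_mem_nhds (hp.pos t x))
  set a : ℝ → ℝ → ℝ := fun t x => fu t x (p t x) with ha
  have hac : Continuous (fun q : ℝ × ℝ => a q.1 q.2) :=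
    a_cont hf hfu1 hfu2 hpc (fun t x => (hp.pos t x).le)
  have hat : ∀ t x, a (t + ω) x = a t x := by
    intro t x
    have h1 := hder (t + ω) x
    rw [hp.per_t] at h1
    have h2 : (fun w => f t x w) =ᶠ[𝓝 (p t x)] fun w => f (t + ω) x w := by
      filter_upwards [Ici_mem_nhds (hp.pos t x)] with w hw
      exact (hf.per_t t x w hw).symm
    have := (h1.congr_of_eventuallyEq h2).unique (hder t x)
    simp only [ha, hp.per_t]; exact this
  have hax : ∀ t x, a t (x + L) = a t x := by
    intro t x
    have h1 := hder t (x + L)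
    rw [hp.per_x] at h1
    have h2 : (fun w => f t x w) =ᶠ[𝓝 (p t x)] fun w => f t (x + L) w := by
      filter_upwards [Ici_mem_nhds (hp.pos t x)] with w hw
      exact (hf.per_x t x w hw).symm
    have := (h1.congr_of_eventuallyEq h2).unique (hder t x)
    simp only [ha, hp.per_x]; exact this
  obtain ⟨A0, hA0, hA0'⟩ := per_bdd hω hL a hac hat hax
  set ε := min ε₀ (1 / 2) with hεd
  have hε : 0 < ε := lt_min hε₀ (by norm_num)
  have hε2 : ε ≤ 1 / 2 := min_le_right _ _
  have hεε : ε ≤ ε₀ := min_le_left _ _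
  have hl : ∀ t x, (1 - ε₀) * p t x < p t x := fun t x => by nlinarith [mul_pos hε₀ (hp.pos t x)]
  have hr : ∀ t x, p t x < (1 + ε₀) * p t x := fun t x => by nlinarith [mul_pos hε₀ (hp.pos t x)]
  have htan : ∀ t x ζ, |ζ| ≤ ε * p t x → f t x (p t x + ζ) - f t x (p t x) ≤ a t x * ζ := by
    intro t x ζ hζ
    have h3 : ε * p t x ≤ ε₀ * p t x := mul_le_mul_of_nonneg_right hεε (hp.pos t x).le
    have h4 := abs_le.1 hζ
    have := tangent1 (hl t x) (hr t x) (hex t x).1 (hder t x) (hex t x).2.2 (p t x + ζ)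
      ⟨by linarith [h4.1], by linarith [h4.2]⟩
    rwa [add_sub_cancel_left] at this
  have hap : ∀ t x, a t x * p t x ≤ f t x (p t x) := fun t x =>
    antitone_tangent (hp.pos t x) (hl t x) (hr t x) (hder t x) (hex t x).2.1
  set κ := ε / 2 with hκ
  have hκ0 : 0 < κ := by positivity
  set e := κ * b with he
  have he0 : 0 < e := by positivity
  have hep : ∀ t x, e ≤ κ * p t x := fun t x => mul_le_mul_of_nonneg_left (hbp t x) hκ0.le
  set A := A0 + 1 with hA
  have hA1 : 0 < A := by positivity
  obtain ⟨K, huK, hup⟩ := fbp_upper hd hω hL hf hp hgh hu₀ hu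
  obtain ⟨S, hS⟩ := hup (e / 4) (by positivity)
  -- the starting time
  obtain ⟨n, hn⟩ := exists_nat_ge ((|S| + 1) / ω)
  rw [div_le_iff₀ hω] at hn
  set T := n * ω with hT
  have hT0 : 0 < T := by linarith [abs_nonneg S]
  have hTS : S ≤ T := by linarith [le_abs_self S]
  obtain ⟨R, hR, hsupp⟩ := fbp_supp hu T
  obtain ⟨k, hk⟩ := exists_nat_ge (8 * R / L)
  rw [div_le_iff₀ hL] at hk
  have hW : 0 < k * L := by linarith
  have hcos : ∀ x, |x| ≤ R → 3 / 4 ≤ Real.cos (Real.pi / (k * L) * x) := by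
    intro x hx
    have h1 : |Real.pi / (k * L) * x| ≤ 1 / 2 := by
      rw [abs_mul, abs_of_pos (div_pos Real.pi_pos hW), div_mul_eq_mul_div, div_le_iff₀ hW]
      have : Real.pi * |x| ≤ 4 * R := mul_le_mul Real.pi_le_four hx (abs_nonneg _) (by norm_num)
      linarith
    have h2 := Real.one_sub_sq_div_two_le_cos (x := Real.pi / (k * L) * x)
    have h3 : (Real.pi / (k * L) * x) ^ 2 ≤ (1 / 2) ^ 2 := sq_le_sq' (by linarith [(abs_le.1 h1).1]) (abs_le.1 h1).2
    linarith
  obtain ⟨δ, hδ, hlin⟩ := lin_main (Q := 2 * A) hd hω hL hW (k := k) rfl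
  have hδ1 : 0 ≤ 1 - δ := by
    obtain ⟨Y, D, -, -, -, -, hYp, -, hm⟩ := hlin (fun _ _ => 0) 0 continuous_const (fun _ _ => le_rfl)
      (fun _ _ => by positivity) (fun _ _ _ => by simp) (fun _ _ => rfl)
    have h1 := hm 1 0
    have h2 := hYp ((1:ℕ) * ω) (by positivity) 0
    rw [pow_one] at h1
    by_contra h3
    have := mul_neg_of_neg_of_pos (not_le.1 h3) h2
    linarith [abs_nonneg (D ((1:ℕ) * ω) 0)]
  obtain ⟨m, hm⟩ := exists_pow_lt_of_lt_one (show (0:ℝ) < 1 / 8 by norm_num) (show 1 - δ < 1 by linarith)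
  set τ := m * ω with hτ
  have hτ0 : 0 ≤ τ := by positivity
  set η := 1 / (6 * (τ + 1)) with hη
  have hη0 : 0 < η := by positivity
  have hη1 : η ≤ 1 := by
    rw [hη, div_le_one (by positivity)]; linarith
  have hητ : η * τ ≤ 1 / 6 := by
    rw [hη, div_mul_eq_mul_div, div_le_iff₀ (by positivity)]; linarith
  have hexp : ∀ t ∈ Icc 0 τ, 5 / 6 ≤ Real.exp (-(η * t)) := by
    intro t ht
    have h1 := Real.add_one_le_exp (-(η * t))
    have h2 : η * t ≤ η * τ := mul_le_mul_of_nonneg_left ht.2 hη0.le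
    linarith
  obtain ⟨c, C, hcc, hc1, hc2, hcl, hcL⟩ := mollify hd hω hL hac hat hax hη0
  have haA := fun t x => abs_le.1 (hA0' t x)
  obtain ⟨Y, D, hY, hD, hY0, hD0, hYp, hDY, hmm⟩ := hlin (fun t x => A - c t x) C (by fun_prop)
    (fun t x => by linarith [(haA t x).2, hc2 t x]) (fun t x => by linarith [(haA t x).1, hc1 t x])
    (fun t x y => by
      have := hcl t x y
      rwa [abs_sub_comm, show c t y - c t x = (A - c t x) - (A - c t y) by ring, abs_sub_comm,
        abs_sub_comm] at this)
    (fun t x => by rw [hcL])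
  set E : ℝ → ℝ := fun t => e * Real.exp (A * t) with hE
  have hEp : ∀ t, 0 < E t := fun t => by positivity
  have hEd : ∀ t, HasDerivAt E (A * E t) t := fun t => by
    have : HasDerivAt (fun t : ℝ => A * t) (A * 1) t := (hasDerivAt_id t).const_mul A
    have := (this.exp).const_mul e
    refine this.congr_deriv ?_
    simp only [hE]; ring
  have hEc : Continuous E := by fun_prop
  set y : ℝ → ℝ → ℝ := fun t x => E t * Y t x with hy
  set D' : ℝ → ℝ → ℝ := fun t x => E t * D t x with hD'
  have hyc : Continuous (fun q : ℝ × ℝ => y q.1 q.2) := (hEc.comp continuous_fst).mul hY.cont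
  have hDc : Continuous (fun q : ℝ × ℝ => D' q.1 q.2) := (hEc.comp continuous_fst).mul hD.cont
  have hyp : ∀ t ≥ 0, ∀ x, 0 < y t x := fun t ht x => mul_pos (hEp t) (hYp t ht x)
  have hDy : ∀ t ≥ 0, ∀ x, |D' t x| ≤ y t x := fun t ht x => by
    simp only [hy, hD', abs_mul, abs_of_pos (hEp t)]
    exact mul_le_mul_of_nonneg_left (hDY t ht x) (hEp t).le
  have hyP : ∀ t > 0, ∀ x, POp d y t x (c t x * y t x) := fun t ht x => by
    convert (hY.pop t ht x).mul_time (hEd t) using 1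
    simp only [hy]; ring
  have hDP : ∀ t > 0, ∀ x, POp d D' t x (c t x * D' t x) := fun t ht x => by
    convert (hD.pop t ht x).mul_time (hEd t) using 1
    simp only [hD']; ring
  have hpP : ∀ t x, POp d p t x (f t x (p t x)) := fun t x =>
    POp.of_solves hp.sol (Eventually.of_forall fun y => mem_univ _)
  have hG1 : ∀ t, HasDerivAt (fun t => Real.exp (η * t)) (η * Real.exp (η * t)) t := fun t => by
    have : HasDerivAt (fun t : ℝ => η * t) (η * 1) t := (hasDerivAt_id t).const_mul η
    refine this.exp.congr_deriv ?_
    ring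
  have hG2 : ∀ t, HasDerivAt (fun t => Real.exp (-(η * t))) (-η * Real.exp (-(η * t))) t := fun t => by
    have : HasDerivAt (fun t : ℝ => -(η * t)) (-(η * 1)) t := ((hasDerivAt_id t).const_mul η).neg
    refine this.exp.congr_deriv ?_
    ring
  -- comparison of the linear solution with `p`
  have hyle : ∀ t ∈ Icc 0 τ, ∀ x, y t x ≤ κ * (Real.exp (η * t) * p t x) := by
    obtain ⟨BY, hBY⟩ := hY.bdd
    have := max_principle (C := A) (T := τ) hd (fun t x => y t x - κ * (Real.exp (η * t) * p t x))
      (by fun_prop)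
      ⟨e * Real.exp (A * τ) * |BY|, fun t ht x => by
        have h1 : y t x ≤ e * Real.exp (A * τ) * |BY| := by
          have h2 : Y t x ≤ |BY| := (le_abs_self _).trans ((hBY t ht.1 x).trans (le_abs_self _))
          have h3 : Real.exp (A * t) ≤ Real.exp (A * τ) :=
            Real.exp_le_exp.2 (mul_le_mul_of_nonneg_left ht.2 hA1.le)
          have h4 := (hYp t ht.1 x).le
          simp only [hy, hE]
          gcongr
        have h2 : 0 < κ * (Real.exp (η * t) * p t x) :=
          mul_pos hκ0 (mul_pos (Real.exp_pos _) (hp.pos t x))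
        linarith⟩
      (fun x => by
        simp only [hy, hE, hY0, mul_zero, Real.exp_zero]
        linarith [hep 0 x])
      (fun t ht x hz => by
        refine ⟨_, (hyP t ht.1 x).sub (((hpP t x).mul_time (hG1 t)).const_mul κ), ?_⟩
        set G := Real.exp (η * t) with hG
        have hGp : 0 < G := Real.exp_pos _
        have h1 : c t x * p t x ≤ f t x (p t x) + η * p t x := by
          have h2 := mul_le_mul_of_nonneg_right (hc2 t x) (hp.pos t x).le
          linarith [hap t x]
        have h2 : κ * (G * (c t x * p t x)) ≤ κ * (G * (f t x (p t x) + η * p t x)) := by gcongr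
        have h3 : c t x * (y t x - κ * (G * p t x)) ≤ A * (y t x - κ * (G * p t x)) :=
          mul_le_mul_of_nonneg_right (by linarith [hc2 t x, (haA t x).2]) hz.le
        linarith)
    intro t ht x
    linarith [this t ht x]
  set Z : ℝ → ℝ → ℝ := fun t x => (D' t x + y t x) - 3 / 2 * (Real.exp (-(η * t)) * y t x) with hZ
  have hZc : Continuous (fun q : ℝ × ℝ => Z q.1 q.2) := by fun_prop
  have hEy : ∀ t ∈ Icc 0 τ, ∀ x, Real.exp (-(η * t)) * y t x ≤ κ * p t x := by
    intro t ht x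
    have h1 := mul_le_mul_of_nonneg_left (hyle t ht x) (Real.exp_pos (-(η * t))).le
    have h2 : Real.exp (-(η * t)) * Real.exp (η * t) = 1 := by rw [← Real.exp_add]; simp
    calc _ ≤ _ := h1
      _ = κ * ((Real.exp (-(η * t)) * Real.exp (η * t)) * p t x) := by ring
      _ = _ := by rw [h2, one_mul]
  have hZb : ∀ t ∈ Icc 0 τ, ∀ x, |Z t x| ≤ ε * p t x := by
    intro t ht x
    have h1 := abs_le.1 (hDy t ht.1 x)
    have h2 := hEy t ht x
    have h3 := hyp t ht.1 x
    have h4 := mul_le_mul_of_nonneg_right (hexp t ht) h3.le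
    have h5 : κ * p t x = ε * p t x / 2 := by simp only [hκ]; ring
    have h6 := mul_pos hε (hp.pos t x)
    rw [abs_le]
    constructor
    · simp only [hZ]; linarith [h1.1]
    · simp only [hZ]; linarith [h1.2]
  have hfT : ∀ t x w, 0 ≤ w → f (T + t) x w = f t x w := fun t x w hw => by
    have h1 := (show Function.Periodic (fun t => f t x w) ω from fun t => hf.per_t t x w hw).nat_mul n t
    rw [add_comm]; exact h1
  have hpT : ∀ t x, p (T + t) x = p t x := fun t x => by
    have h1 := (show Function.Periodic (fun t => p t x) ω from fun t => hp.per_t t x).nat_mul n t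
    rw [add_comm]; exact h1
  set K' := max K (2 * Bp) with hK'
  obtain ⟨Λ, hΛ0, hΛ⟩ := f_lip hω hL hf K'
  have hpZ : ∀ t ∈ Icc 0 τ, ∀ x, 0 < p t x + Z t x := fun t ht x => by
    have h1 := (abs_le.1 (hZb t ht x)).1
    have h2 := mul_le_mul_of_nonneg_right hε2 (hp.pos t x).le
    linarith [hp.pos t x]
  have hfin := max_principle (C := Λ) (T := τ) hd (fun t x => u (T + t) x - p t x - Z t x)
    (by
      refine ContinuousOn.sub (ContinuousOn.sub ?_ hpc.continuousOn) hZc.continuousOn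
      exact (fbp_cont hgh hu₀ hu).comp (f := fun q : ℝ × ℝ => (T + q.1, q.2)) (by fun_prop)
        (fun q hq => by show 0 ≤ T + q.1; linarith [hq.1.1]))
    ⟨K, fun t ht x => by linarith [hpZ t ht x, huK (T + t) (by linarith [ht.1]) x]⟩
    (fun x => by
      have e1 : Z 0 x = e * (Real.cos (Real.pi / (k * L) * x) - 1 / 2) := by
        simp only [hZ, hD', hy, hE, hY0, hD0, mul_zero, neg_zero, Real.exp_zero]; ring
      simp only [add_zero]
      by_cases hx : |x| ≤ R
      · have h1 := hS T hTS hT0.le x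
        have h2 := hpT 0 x
        rw [add_zero] at h2
        have h3 : e * (3 / 4 - 1 / 2) ≤ Z 0 x := by
          rw [e1]; exact mul_le_mul_of_nonneg_left (by linarith [hcos x hx]) he0.le
        linarith
      · rw [hsupp T ⟨hT0.le, le_rfl⟩ x (not_le.1 hx)]
        linarith [hpZ 0 ⟨le_rfl, hτ0⟩ x])
    (fun t ht x hz => by
      have ht' : t ∈ Icc 0 τ := ⟨ht.1.le, ht.2⟩
      have hw := hpZ t ht' x
      have hup : 0 < u (T + t) x := by linarith
      have hu1 : POp d (fun t x => u (T + t) x) t x (f t x (u (T + t) x)) := by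
        have h1 := fbp_POp hgh hu₀ hu (t := T + t) (x := 0 + x) (by linarith [ht.1])
          (by rw [zero_add]; exact hup.ne')
        have h2 := h1.shift T 0
        simp only [zero_add] at h2
        rwa [hfT t x _ hup.le] at h2
      have hZP : POp d Z t x _ := ((hDP t ht.1 x).add (hyP t ht.1 x)).sub
        (((hyP t ht.1 x).mul_time (hG2 t)).const_mul (3 / 2))
      refine ⟨_, (hu1.sub (hpP t x)).sub hZP, ?_⟩
      have hDy1 := abs_le.1 (hDy t ht.1.le x)
      have hy1 := hyp t ht.1.le x
      have h1 := htan t x (Z t x) (hZb t ht' x)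
      have hZb' := abs_le.1 (hZb t ht' x)
      have hBp' := (le_abs_self _).trans (hBp t x)
      have h2 := hΛ t x (u (T + t) x)
        ⟨hup.le, (huK (T + t) (by linarith [ht.1]) x).trans (le_max_left _ _)⟩ (p t x + Z t x)
        ⟨hw.le, le_trans (by
          have := mul_le_mul_of_nonneg_right hε2 (hp.pos t x).le
          linarith [hp.pos t x, hZb'.2]) (le_max_right K (2 * Bp))⟩
      have e2 : u (T + t) x - (p t x + Z t x) = u (T + t) x - p t x - Z t x := by ring
      rw [e2, abs_of_pos hz] at h2
      have h3 := (le_abs_self _).trans h2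
      set G := Real.exp (-(η * t)) with hG
      have hGp : 0 < G := Real.exp_pos _
      have h4 : a t x * (D' t x + y t x) ≤ c t x * (D' t x + y t x) :=
        mul_le_mul_of_nonneg_right (hc1 t x) (by linarith [hDy1.1])
      have h5 : (c t x - η) * (G * y t x) ≤ a t x * (G * y t x) :=
        mul_le_mul_of_nonneg_right (by linarith [hc2 t x]) (by positivity)
      have e3 : a t x * Z t x = a t x * (D' t x + y t x) - 3 / 2 * (a t x * (G * y t x)) := by
        simp only [hZ, ← hG]; ring
      linarith)
  refine ⟨T + τ, by linarith, fun x => ?_⟩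
  have hττ : τ ∈ Icc 0 τ := ⟨hτ0, le_rfl⟩
  have h1 := hfin τ hττ x
  have h2 : p τ x = p 0 x := by
    have h1 := (show Function.Periodic (fun t => p t x) ω from fun t => hp.per_t t x).nat_mul m 0
    simpa [hτ] using h1
  have hy1 := hyp τ hτ0 x
  have h3 : D' τ x ≤ 1 / 8 * y τ x := by
    have h4 := (le_abs_self _).trans (hmm m x)
    have h5 : (1 - δ) ^ m * Y (m * ω) x ≤ 1 / 8 * Y (m * ω) x :=
      mul_le_mul_of_nonneg_right hm.le (hYp τ hτ0 x).le
    have h6 := mul_le_mul_of_nonneg_left (h4.trans h5) (hEp τ).le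
    simp only [hD', hy]
    linarith
  have h4 := mul_le_mul_of_nonneg_right (hexp τ hττ) hy1.le
  have h5 : Z τ x < 0 := by
    simp only [hZ]; linarith
  linarith
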